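/- arXiv:1508.04193 — 4 statements merged into one kernel-verified Lean document; each statement's English description precedes it below -/
import Mathlib

section
/- For every ε > 0 there exist an integer D and a real δ > 0 such that for every finite field F with q elements and every integer d with d ≥ D and d ≤ δ·√q, the average period satisfies (1/(q^d(q−1))) · Σ_{f ∈ Ω(q,d)} T(f) ≥ (1 − ε)·d/2. -/
open Polynomial

/-- The ultimate period of `f : F → F` on a finite set `F`: the least `t ≥ 1` such that
`f^[n+t] = f^[n]` for all `n ≥ |F|`. It equals the least common multiple of the cycle
lengths of `f`. -/
noncomputable def ultPeriod {F : Type*} [Fintype F] (f : F → F) : ℕ :=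
  sInf {t : ℕ | 1 ≤ t ∧ ∀ n : ℕ, Fintype.card F ≤ n → f^[n + t] = f^[n]}

theorem ultPeriod_spec {F : Type*} [Fintype F] (f : F → F) :
    1 ≤ ultPeriod f ∧ ∀ n : ℕ, Fintype.card F ≤ n → f^[n + ultPeriod f] = f^[n] := by
  refine Nat.sInf_mem (s := {t : ℕ | 1 ≤ t ∧ ∀ n : ℕ, Fintype.card F ≤ n → f^[n + t] = f^[n]})
    ⟨(Fintype.card F).factorial, Nat.factorial_pos _, fun n hn => funext fun x => ?_⟩
  obtain ⟨i, j, hij, h⟩ : ∃ i j : Fin (Fintype.card F + 1), i < j ∧ f^[i] x = f^[j] x := by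
    obtain ⟨i, j, hne, h⟩ := Fintype.exists_ne_map_eq_of_card_lt
      (fun i : Fin (Fintype.card F + 1) => f^[i] x) (by simp)
    rcases lt_or_gt_of_ne hne with h' | h'
    · exact ⟨i, j, h', h⟩
    · exact ⟨j, i, h', h.symm⟩
  have hij' : (i : ℕ) < j := hij
  have hper : Function.IsPeriodicPt f (j - i : ℕ) (f^[n] x) := by
    have h0 : Function.IsPeriodicPt f (j - i : ℕ) (f^[i] x) := by
      rw [Function.IsPeriodicPt, Function.IsFixedPt, ← Function.iterate_add_apply,
        Nat.sub_add_cancel hij'.le, h]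
    have := h0.apply_iterate (n - i)
    rwa [← Function.iterate_add_apply, Nat.sub_add_cancel (by omega)] at this
  rw [add_comm, Function.iterate_add_apply]
  exact hper.trans_dvd (Nat.dvd_factorial (by omega) (by omega))

theorem minimalPeriod_dvd_ultPeriod {F : Type*} [Fintype F] (f : F → F) {x : F}
    (hx : 0 < Function.minimalPeriod f x) : Function.minimalPeriod f x ∣ ultPeriod f := by
  apply Function.IsPeriodicPt.minimalPeriod_dvd
  have h := congrFun ((ultPeriod_spec f).2 (Fintype.card F * Function.minimalPeriod f x)
    (Nat.le_mul_of_pos_right _ hx)) x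
  have h1 : f^[Fintype.card F * Function.minimalPeriod f x] x = x :=
    (Function.isPeriodicPt_minimalPeriod f x).const_mul _
  rwa [add_comm, Function.iterate_add_apply, h1] at h

theorem exists_iterate_eq_of_iterate_eq {F : Type*} {f : F → F} {x y : F}
    (hy : 0 < Function.minimalPeriod f y) {a b : ℕ} (h : f^[a] x = f^[b] y) :
    ∃ c, f^[c] x = y := by
  refine ⟨b * (Function.minimalPeriod f y - 1) + a, ?_⟩
  rw [Function.iterate_add_apply, h, ← Function.iterate_add_apply,
    show b * (Function.minimalPeriod f y - 1) + b = b * Function.minimalPeriod f y by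
      obtain ⟨p, hp⟩ := Nat.exists_eq_succ_of_ne_zero hy.ne'
      rw [hp]; simp [Nat.mul_succ]]
  exact (Function.isPeriodicPt_minimalPeriod f y).const_mul _

open scoped Classical in
/-- The points whose minimal period lies in `K`. -/
noncomputable def pointsWithPeriod {F : Type*} [Fintype F] (f : F → F) (K : Finset ℕ) : Finset F :=
  {x | Function.minimalPeriod f x ∈ K}

open scoped Classical in
/-- The pairs of points on different orbits whose pair of minimal periods lies in `R`. -/
noncomputable def separatedPairs {F : Type*} [Fintype F] (f : F → F) (R : Finset (ℕ × ℕ)) :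
    Finset (F × F) :=
  {p | (Function.minimalPeriod f p.1, Function.minimalPeriod f p.2) ∈ R ∧ ∀ c, f^[c] p.1 ≠ p.2}

open scoped Classical in
theorem card_orbit_le {F : Type*} [Fintype F] (f : F → F) {x : F}
    (hx : 0 < Function.minimalPeriod f x) :
    (Finset.univ.filter fun y => ∃ c, f^[c] x = y).card ≤ Function.minimalPeriod f x := by
  calc _ ≤ ((Finset.range (Function.minimalPeriod f x)).image fun c => f^[c] x).card := by
        apply Finset.card_le_card
        rintro y hy
        obtain ⟨c, rfl⟩ := (Finset.mem_filter.1 hy).2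
        exact Finset.mem_image.2 ⟨c % Function.minimalPeriod f x,
          Finset.mem_range.2 (Nat.mod_lt _ hx), Function.iterate_mod_minimalPeriod_eq⟩
    _ ≤ _ := Finset.card_image_le.trans (by simp)

open scoped Classical in
theorem card_pointsWithPeriod_le {F : Type*} [Fintype F] (f : F → F) {N m : ℕ} (hN : 1 ≤ N)
    (hm : 2 * N ^ 4 ≤ m) :
    ((pointsWithPeriod f (Finset.Ioc (m / N) m)).card : ℝ) ≤ ultPeriod f +
      (N / m : ℝ) * (separatedPairs f ((Finset.Ioc (m / N) m ×ˢ Finset.Ioc (m / N) m).filter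
        fun p => N ^ 2 < p.1.gcd p.2)).card +
      (2 * N ^ 4 / m ^ 2 : ℝ) *
        (separatedPairs f (Finset.Ioc (m / N) m ×ˢ Finset.Ioc (m / N) m)).card := by
  set K := Finset.Ioc (m / N) m with hK
  set S := pointsWithPeriod f K with hS
  set Y := separatedPairs f ((K ×ˢ K).filter fun p => N ^ 2 < p.1.gcd p.2) with hY
  set Z := separatedPairs f (K ×ˢ K) with hZ
  have hN4 : 1 ≤ N ^ 4 := Nat.one_le_pow _ _ hN
  have hm0 : (0 : ℝ) < m := by exact_mod_cast (by omega : 0 < m)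
  have hmemS : ∀ x, x ∈ S ↔ Function.minimalPeriod f x ∈ K := fun x => by
    simp [hS, pointsWithPeriod]
  have hSpos : ∀ x ∈ S, 0 < Function.minimalPeriod f x := fun x hx => by
    have := (Finset.mem_Ioc.1 ((hmemS x).1 hx)).1
    exact pos_of_gt this
  have hSle : ∀ x ∈ S, Function.minimalPeriod f x ≤ m := fun x hx =>
    (Finset.mem_Ioc.1 ((hmemS x).1 hx)).2
  have hSlow : ∀ x ∈ S, m ≤ Function.minimalPeriod f x * N := fun x hx =>
    ((Nat.div_lt_iff_lt_mul hN).1 (Finset.mem_Ioc.1 ((hmemS x).1 hx)).1).le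
  have hYnn : (0 : ℝ) ≤ (N / m : ℝ) * Y.card := by positivity
  have hZnn : (0 : ℝ) ≤ (2 * N ^ 4 / m ^ 2 : ℝ) * Z.card := by positivity
  have hTpos := (ultPeriod_spec f).1
  by_cases h1 : ∃ x ∈ S, ∀ y ∈ S, ∃ c, f^[c] x = y
  · obtain ⟨x, hx, hxy⟩ := h1
    have : S.card ≤ ultPeriod f :=
      calc S.card ≤ (Finset.univ.filter fun y => ∃ c, f^[c] x = y).card :=
            Finset.card_le_card fun y hy => by simpa using hxy y hy
        _ ≤ Function.minimalPeriod f x := card_orbit_le f (hSpos x hx)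
        _ ≤ ultPeriod f := Nat.le_of_dvd hTpos (minimalPeriod_dvd_ultPeriod f (hSpos x hx))
    have : (S.card : ℝ) ≤ ultPeriod f := by exact_mod_cast this
    linarith
  push Not at h1
  by_cases h2 : ∃ x ∈ S, ∃ y ∈ S,
      (Function.minimalPeriod f x).gcd (Function.minimalPeriod f y) ≤ N ^ 2
  · obtain ⟨x, hx, y, hy, hg⟩ := h2
    have hT : m ^ 2 ≤ ultPeriod f * N ^ 4 := by
      have hl : (Function.minimalPeriod f x).lcm (Function.minimalPeriod f y) ≤ ultPeriod f :=
        Nat.le_of_dvd hTpos (Nat.lcm_dvd (minimalPeriod_dvd_ultPeriod f (hSpos x hx))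
          (minimalPeriod_dvd_ultPeriod f (hSpos y hy)))
      calc m ^ 2 = m * m := sq m
        _ ≤ (Function.minimalPeriod f x * N) * (Function.minimalPeriod f y * N) :=
          Nat.mul_le_mul (hSlow x hx) (hSlow y hy)
        _ = ((Function.minimalPeriod f x).gcd (Function.minimalPeriod f y) *
            (Function.minimalPeriod f x).lcm (Function.minimalPeriod f y)) * N ^ 2 := by
          rw [Nat.gcd_mul_lcm]; ring
        _ ≤ (N ^ 2 * ultPeriod f) * N ^ 2 := by gcongr
        _ = _ := by ring
    by_cases hXT : S.card ≤ ultPeriod f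
    · have : (S.card : ℝ) ≤ ultPeriod f := by exact_mod_cast hXT
      linarith
    have hXm : m ^ 2 ≤ S.card * N ^ 4 := hT.trans (by gcongr; omega)
    have hX2 : 2 * m ≤ S.card := by
      have : (2 * m) * N ^ 4 ≤ S.card * N ^ 4 := by nlinarith
      exact Nat.le_of_mul_le_mul_right this (by omega)
    have hsq : S.card * S.card ≤ Z.card + m * S.card := by
      calc S.card * S.card = (S ×ˢ S).card := (Finset.card_product _ _).symm
        _ ≤ (Z ∪ S.biUnion fun x =>
              (Finset.univ.filter fun y => ∃ c, f^[c] x = y).image (Prod.mk x)).card := by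
          refine Finset.card_le_card fun p hp => ?_
          obtain ⟨hp1, hp2⟩ := Finset.mem_product.1 hp
          by_cases h : ∃ c, f^[c] p.1 = p.2
          · exact Finset.mem_union_right _ (Finset.mem_biUnion.2 ⟨p.1, hp1,
              Finset.mem_image.2 ⟨p.2, by simpa using h, rfl⟩⟩)
          · push Not at h
            refine Finset.mem_union_left _ (Finset.mem_filter.2 ⟨Finset.mem_univ _, ?_, h⟩)
            exact Finset.mem_product.2 ⟨(hmemS _).1 hp1, (hmemS _).1 hp2⟩
        _ ≤ Z.card + m * S.card := by
          refine (Finset.card_union_le _ _).trans (Nat.add_le_add_left ?_ _)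
          rw [mul_comm]
          exact Finset.card_biUnion_le_card_mul _ _ _ fun x hx =>
            Finset.card_image_le.trans ((card_orbit_le f (hSpos x hx)).trans (hSle x hx))
    have h3 : S.card * m ^ 2 ≤ 2 * N ^ 4 * Z.card := by
      have : S.card * S.card ≤ 2 * Z.card := by nlinarith
      calc S.card * m ^ 2 ≤ S.card * (S.card * N ^ 4) := by gcongr
        _ = (S.card * S.card) * N ^ 4 := by ring
        _ ≤ (2 * Z.card) * N ^ 4 := by gcongr
        _ = _ := by ring
    have h4 : (S.card : ℝ) ≤ (2 * N ^ 4 / m ^ 2 : ℝ) * Z.card := by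
      rw [div_mul_eq_mul_div, le_div_iff₀ (by positivity)]
      exact_mod_cast h3
    have : (0 : ℝ) ≤ ultPeriod f := by positivity
    linarith
  · push Not at h2
    have h3 : S.card * m ≤ N * Y.card := by
      have hmaps : Set.MapsTo Prod.fst (Y : Set (F × F)) (S : Set F) := fun p hp => by
        have := Finset.mem_product.1 (Finset.mem_filter.1 (Finset.mem_filter.1 hp).2.1).1
        exact (hmemS _).2 this.1
      rw [Finset.card_eq_sum_card_fiberwise hmaps, Finset.mul_sum, ← smul_eq_mul]
      refine Finset.card_nsmul_le_sum _ _ _ fun x hx => ?_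
      obtain ⟨y, hy, hxy⟩ := h1 x hx
      have hyper := Function.minimalPeriod_pos_iff_mem_periodicPts.1 (hSpos y hy)
      calc m ≤ Function.minimalPeriod f y * N := hSlow y hy
        _ = N * ((Finset.range (Function.minimalPeriod f y)).image fun c => (x, f^[c] y)).card := by
          rw [Finset.card_image_of_injOn, Finset.card_range, mul_comm]
          intro a ha b hb hab
          exact Function.iterate_injOn_Iio_minimalPeriod (by simpa using ha) (by simpa using hb)
            (Prod.ext_iff.1 hab).2
        _ ≤ _ := by
          refine Nat.mul_le_mul_left _ (Finset.card_le_card fun p hp => ?_)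
          obtain ⟨c, -, rfl⟩ := Finset.mem_image.1 hp
          have hcy : f^[c] y ∈ S := by
            rw [hmemS, Function.minimalPeriod_apply_iterate hyper]
            exact (hmemS y).1 hy
          refine Finset.mem_filter.2 ⟨Finset.mem_filter.2 ⟨Finset.mem_univ _,
            Finset.mem_filter.2 ⟨Finset.mem_product.2 ⟨(hmemS _).1 hx, (hmemS _).1 hcy⟩,
              h2 x hx _ hcy⟩, fun e he => ?_⟩, rfl⟩
          obtain ⟨e', he'⟩ := exists_iterate_eq_of_iterate_eq (hSpos y hy) he
          exact hxy e' he'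
    have h4 : (S.card : ℝ) ≤ (N / m : ℝ) * Y.card := by
      rw [div_mul_eq_mul_div, le_div_iff₀ (by positivity)]
      exact_mod_cast h3
    have : (0 : ℝ) ≤ ultPeriod f := by positivity
    linarith

/-- A finite family of self-maps of `F` whose values at any `d` distinct points are independent and
uniformly distributed. -/
def IsUniformUpTo {Ω F : Type} [Fintype Ω] [Fintype F] (φ : Ω → F → F) (d : ℕ) : Prop :=
  ∀ (ι : Type) [Fintype ι] (w : ι ↪ F) (v : ι → F), Fintype.card ι ≤ d →
    Nat.card {ω // ∀ i, φ ω (w i) = v i} * Fintype.card F ^ Fintype.card ι = Fintype.card Ω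

open scoped Classical in
theorem IsUniformUpTo.sum_card_embedding {Ω F : Type} [Fintype Ω] [Fintype F] {φ : Ω → F → F}
    {d : ℕ} (hφ : IsUniformUpTo φ d) {ι : Type} [Fintype ι] (hι : Fintype.card ι ≤ d)
    (σ : ι → ι) :
    (∑ ω, (Finset.univ.filter fun w : ι ↪ F => ∀ i, φ ω (w i) = w (σ i)).card) *
      Fintype.card F ^ Fintype.card ι =
        Fintype.card Ω * (Fintype.card F).descFactorial (Fintype.card ι) := by
  have := Finset.sum_card_bipartiteAbove_eq_sum_card_bipartiteBelow (s := Finset.univ)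
    (t := Finset.univ) (fun (ω : Ω) (w : ι ↪ F) => ∀ i, φ ω (w i) = w (σ i))
  simp only [Finset.bipartiteAbove, Finset.bipartiteBelow] at this
  rw [this, Finset.sum_mul, Finset.sum_congr rfl (g := fun _ => Fintype.card Ω)]
  · rw [Finset.sum_const, Finset.card_univ, Fintype.card_embedding_eq, smul_eq_mul, mul_comm]
  · intro w _
    rw [← hφ ι w (fun i => w (σ i)) hι, Nat.card_eq_fintype_card, Fintype.card_subtype]

theorem iterate_apply_zero_of_semiconj {F : Type} {f : F → F} {k : ℕ} {w : ZMod k → F}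
    (h : ∀ i, f (w i) = w (i + 1)) (n : ℕ) : f^[n] (w 0) = w n := by
  induction n with
  | zero => simp
  | succ n ih => rw [Function.iterate_succ_apply', ih, h, Nat.cast_succ]

theorem minimalPeriod_apply_zero_of_semiconj {F : Type} {f : F → F} {k : ℕ} {w : ZMod k → F}
    (hw : Function.Injective w) (h : ∀ i, f (w i) = w (i + 1)) :
    Function.minimalPeriod f (w 0) = k := by
  have key : ∀ n, Function.minimalPeriod f (w 0) ∣ n ↔ k ∣ n := fun n => by
    rw [← Function.isPeriodicPt_iff_minimalPeriod_dvd, Function.IsPeriodicPt, Function.IsFixedPt,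
      iterate_apply_zero_of_semiconj h, hw.eq_iff, ZMod.natCast_eq_zero_iff]
  exact Nat.dvd_antisymm ((key k).2 dvd_rfl) ((key _).1 dvd_rfl)

theorem iterate_val_add_one {F : Type} {f : F → F} {k : ℕ} [NeZero k] {x : F}
    (hx : Function.minimalPeriod f x = k) (i : ZMod k) : f (f^[i.val] x) = f^[(i + 1).val] x := by
  rw [← Function.iterate_succ_apply' f, ← Function.iterate_mod_minimalPeriod_eq, hx, Nat.succ_eq_add_one,
    show (i.val + 1) % k = (i + 1).val by
      rw [← ZMod.val_natCast, Nat.cast_succ, ZMod.natCast_val, ZMod.cast_id]]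

open scoped Classical in
theorem IsUniformUpTo.le_sum_card_minimalPeriod_eq {Ω F : Type} [Fintype Ω] [Fintype F]
    {φ : Ω → F → F} {d : ℕ} (hφ : IsUniformUpTo φ d) {k : ℕ} (hk : 0 < k) (hkd : k ≤ d) :
    Fintype.card Ω * (Fintype.card F).descFactorial k ≤
      (∑ ω, (Finset.univ.filter fun x => Function.minimalPeriod (φ ω) x = k).card) *
        Fintype.card F ^ k := by
  have : NeZero k := ⟨hk.ne'⟩
  have h := hφ.sum_card_embedding (ι := ZMod k) (by rwa [ZMod.card]) (fun i => i + 1)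
  rw [ZMod.card] at h
  rw [← h]
  refine Nat.mul_le_mul_right _ (Finset.sum_le_sum fun ω _ => ?_)
  refine Finset.card_le_card_of_injOn (fun w => w 0) (fun w hw => ?_) (fun w hw w' hw' h0 => ?_)
  · simpa using minimalPeriod_apply_zero_of_semiconj w.injective (Finset.mem_filter.1 hw).2
  · ext i
    have h1 := iterate_apply_zero_of_semiconj (Finset.mem_filter.1 hw).2 i.val
    have h2 := iterate_apply_zero_of_semiconj (Finset.mem_filter.1 hw').2 i.val
    rw [ZMod.natCast_val, ZMod.cast_id] at h1 h2
    rw [← h1, ← h2]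
    exact congrArg _ h0

open scoped Classical in
theorem IsUniformUpTo.sum_card_separatedPairs_singleton_le {Ω F : Type} [Fintype Ω] [Fintype F]
    [Nonempty F] {φ : Ω → F → F} {d : ℕ} (hφ : IsUniformUpTo φ d) {i j : ℕ} (hi : 0 < i)
    (hj : 0 < j) (hij : i + j ≤ d) :
    ∑ ω, (separatedPairs (φ ω) {(i, j)}).card ≤ Fintype.card Ω := by
  have : NeZero i := ⟨hi.ne'⟩
  have : NeZero j := ⟨hj.ne'⟩
  have h := hφ.sum_card_embedding (ι := ZMod i ⊕ ZMod j) (by simpa [ZMod.card] using hij)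
    (Sum.map (fun a => a + 1) (fun a => a + 1))
  have hle : ∑ ω, (separatedPairs (φ ω) {(i, j)}).card ≤
      ∑ ω, (Finset.univ.filter fun w : ZMod i ⊕ ZMod j ↪ F =>
        ∀ a, φ ω (w a) = w (Sum.map (fun a => a + 1) (fun a => a + 1) a)).card := by
    refine Finset.sum_le_sum fun ω _ => ?_
    have hmem : ∀ p ∈ separatedPairs (φ ω) {(i, j)}, ∃ w : ZMod i ⊕ ZMod j ↪ F,
        (∀ a, φ ω (w a) = w (Sum.map (fun a => a + 1) (fun a => a + 1) a)) ∧
          (w (Sum.inl 0), w (Sum.inr 0)) = p := by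
      rintro ⟨x, y⟩ hp
      obtain ⟨hp, hxy⟩ := (Finset.mem_filter.1 hp).2
      obtain ⟨hx, hy⟩ := Prod.ext_iff.1 (Finset.mem_singleton.1 hp)
      simp only at hx hy hxy
      have hinj : ∀ {k : ℕ} [NeZero k] {z : F}, Function.minimalPeriod (φ ω) z = k →
          Function.Injective fun a : ZMod k => (φ ω)^[a.val] z := fun hz a b hab =>
        ZMod.val_injective _ (Function.iterate_injOn_Iio_minimalPeriod
          (by rw [Set.mem_Iio, hz]; exact ZMod.val_lt a)
          (by rw [Set.mem_Iio, hz]; exact ZMod.val_lt b) hab)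
      refine ⟨⟨Sum.elim (fun a => (φ ω)^[a.val] x) (fun a => (φ ω)^[a.val] y),
        (hinj hx).sumElim (hinj hy) fun a b hab => ?_⟩, ?_, ?_⟩
      · obtain ⟨c, hc⟩ := exists_iterate_eq_of_iterate_eq (hy ▸ hj) hab
        exact hxy c hc
      · rintro (a | a)
        · exact iterate_val_add_one hx a
        · exact iterate_val_add_one hy a
      · simp
    have : Nonempty (ZMod i ⊕ ZMod j ↪ F) ∨ separatedPairs (φ ω) {(i, j)} = ∅ := by
      rcases Finset.eq_empty_or_nonempty (separatedPairs (φ ω) {(i, j)}) with h | ⟨p, hp⟩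
      · exact Or.inr h
      · exact Or.inl ⟨(hmem p hp).choose⟩
    rcases this with _ | h0
    swap
    · simp [h0]
    choose! g hg1 hg2 using hmem
    refine Finset.card_le_card_of_injOn g (fun p hp => by simpa using hg1 p hp)
      (fun p hp p' hp' h0 => ?_)
    rw [← hg2 p hp, ← hg2 p' hp', h0]
  have hq : 0 < Fintype.card F ^ Fintype.card (ZMod i ⊕ ZMod j) := pow_pos Fintype.card_pos _
  refine Nat.le_of_mul_le_mul_right ((Nat.mul_le_mul_right _ hle).trans ?_) hq
  rw [h]
  exact Nat.mul_le_mul_left _ (Nat.descFactorial_le_pow _ _)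

theorem IsUniformUpTo.sum_card_separatedPairs_le {Ω F : Type} [Fintype Ω] [Fintype F]
    [Nonempty F] {φ : Ω → F → F} {d : ℕ} (hφ : IsUniformUpTo φ d) (R : Finset (ℕ × ℕ))
    (hR : ∀ p ∈ R, 0 < p.1 ∧ 0 < p.2 ∧ p.1 + p.2 ≤ d) :
    ∑ ω, (separatedPairs (φ ω) R).card ≤ R.card * Fintype.card Ω := by
  classical
  have h : ∀ ω, (separatedPairs (φ ω) R).card = ∑ p ∈ R, (separatedPairs (φ ω) {p}).card := by
    intro ω
    rw [Finset.card_eq_sum_card_fiberwise (t := R) (f := fun p =>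
      (Function.minimalPeriod (φ ω) p.1, Function.minimalPeriod (φ ω) p.2))
      fun p hp => (Finset.mem_filter.1 hp).2.1]
    refine Finset.sum_congr rfl fun p hp => congrArg _ (Finset.ext fun a => ?_)
    simp only [separatedPairs, Finset.mem_filter, Finset.mem_univ, true_and, Finset.mem_singleton]
    constructor
    · rintro ⟨⟨-, h1⟩, h2⟩
      exact ⟨h2, h1⟩
    · rintro ⟨h2, h1⟩
      exact ⟨⟨h2 ▸ hp, h1⟩, h2⟩
  simp_rw [h]
  rw [Finset.sum_comm, ← smul_eq_mul]
  exact Finset.sum_le_card_nsmul _ _ _ fun p hp =>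
    hφ.sum_card_separatedPairs_singleton_le (hR p hp).1 (hR p hp).2.1 (hR p hp).2.2

theorem one_sub_le_descFactorial_div {q k m : ℕ} (hkm : k ≤ m) (hmq : m ≤ q) (hq : 0 < q) :
    1 - (m : ℝ) ^ 2 / q ≤ (q.descFactorial k : ℝ) / q ^ k := by
  have hq' : (0 : ℝ) < q := by exact_mod_cast hq
  have hkm' : (k : ℝ) ≤ m := by exact_mod_cast hkm
  have hkq' : (k : ℝ) ≤ q := by exact_mod_cast hkm.trans hmq
  have h1 : ((q : ℝ) - k) ^ k ≤ q.descFactorial k := by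
    have h : (q - k) ^ k ≤ q.descFactorial k :=
      (Nat.pow_le_pow_left (by omega) k).trans (Nat.pow_sub_le_descFactorial q k)
    rw [← Nat.cast_sub (hkm.trans hmq)]
    exact_mod_cast h
  calc 1 - (m : ℝ) ^ 2 / q ≤ 1 - (k : ℝ) ^ 2 / q := by gcongr
    _ = 1 + k * (-(k / q : ℝ)) := by ring
    _ ≤ (1 + -(k / q : ℝ)) ^ k := one_add_mul_le_pow (by
      have : (k / q : ℝ) ≤ 1 := (div_le_one hq').2 hkq'
      linarith) k
    _ = ((q : ℝ) - k) ^ k / q ^ k := by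
      rw [← div_pow]; congr 1; field_simp; ring
    _ ≤ _ := by gcongr

theorem IsUniformUpTo.le_sum_card_pointsWithPeriod {Ω F : Type} [Fintype Ω] [Fintype F]
    [Nonempty F] {φ : Ω → F → F} {d : ℕ} (hφ : IsUniformUpTo φ d) {K : Finset ℕ} {m : ℕ}
    (hK : ∀ k ∈ K, 0 < k ∧ k ≤ m) (hmd : m ≤ d) (hmq : m ≤ Fintype.card F) :
    (Fintype.card Ω : ℝ) * (K.card * (1 - (m : ℝ) ^ 2 / Fintype.card F)) ≤
      ∑ ω, ((pointsWithPeriod (φ ω) K).card : ℝ) := by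
  classical
  have h : ∀ ω, (pointsWithPeriod (φ ω) K).card =
      ∑ k ∈ K, (Finset.univ.filter fun x => Function.minimalPeriod (φ ω) x = k).card := by
    intro ω
    rw [Finset.card_eq_sum_card_fiberwise (t := K) (f := Function.minimalPeriod (φ ω))
      (s := pointsWithPeriod (φ ω) K) fun p hp => (Finset.mem_filter.1 hp).2]
    refine Finset.sum_congr rfl fun k hk => congrArg _ (Finset.ext fun a => ?_)
    simp only [pointsWithPeriod, Finset.mem_filter, Finset.mem_univ, true_and]
    exact ⟨fun h => h.2, fun h => ⟨h ▸ hk, h⟩⟩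
  simp_rw [h]
  push_cast
  rw [Finset.sum_comm, mul_left_comm, ← nsmul_eq_mul]
  refine Finset.card_nsmul_le_sum _ _ _ fun k hk => ?_
  have hq : 0 < Fintype.card F := Fintype.card_pos
  have hq' : (0 : ℝ) < (Fintype.card F : ℝ) ^ k := by positivity
  have h1 := hφ.le_sum_card_minimalPeriod_eq (hK k hk).1 ((hK k hk).2.trans hmd)
  calc _ ≤ (Fintype.card Ω : ℝ) * ((Fintype.card F).descFactorial k / (Fintype.card F : ℝ) ^ k) :=
        mul_le_mul_of_nonneg_left (one_sub_le_descFactorial_div (hK k hk).2 hmq hq) (by positivity)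
    _ ≤ _ := by
      rw [← mul_div_assoc, div_le_iff₀ hq']
      exact_mod_cast h1

theorem card_filter_lt_gcd_le {g : ℕ} (hg : 0 < g) (m : ℕ) (s : Finset (ℕ × ℕ))
    (hs : s ⊆ (Finset.Ioc 0 m ×ˢ Finset.Ioc 0 m).filter fun p => g < p.1.gcd p.2) :
    (s.card : ℝ) ≤ (m : ℝ) ^ 2 / g := by
  classical
  have h : s.card ≤ ∑ e ∈ Finset.Ioc g m, (m / e) ^ 2 := by
    calc s.card ≤ ((Finset.Ioc g m).biUnion fun e =>
          (Finset.Ioc 0 (m / e) ×ˢ Finset.Ioc 0 (m / e)).image fun p => (e * p.1, e * p.2)).card := by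
          refine Finset.card_le_card fun p hp => ?_
          obtain ⟨hp1, hp2⟩ := Finset.mem_filter.1 (hs hp)
          obtain ⟨ha, hb⟩ := Finset.mem_product.1 hp1
          rw [Finset.mem_Ioc] at ha hb
          have he : 0 < p.1.gcd p.2 := pos_of_gt hp2
          have h1 := Nat.gcd_dvd_left p.1 p.2
          have h2 := Nat.gcd_dvd_right p.1 p.2
          refine Finset.mem_biUnion.2 ⟨p.1.gcd p.2,
            Finset.mem_Ioc.2 ⟨hp2, (Nat.le_of_dvd ha.1 h1).trans ha.2⟩,
            Finset.mem_image.2 ⟨(p.1 / p.1.gcd p.2, p.2 / p.1.gcd p.2), ?_, ?_⟩⟩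
          · simp only [Finset.mem_product, Finset.mem_Ioc]
            exact ⟨⟨Nat.div_pos (Nat.le_of_dvd ha.1 h1) he, Nat.div_le_div_right ha.2⟩,
              Nat.div_pos (Nat.le_of_dvd hb.1 h2) he, Nat.div_le_div_right hb.2⟩
          · exact Prod.ext (Nat.mul_div_cancel' h1) (Nat.mul_div_cancel' h2)
      _ ≤ _ := by
          refine Finset.card_biUnion_le.trans (Finset.sum_le_sum fun e _ => ?_)
          exact Finset.card_image_le.trans (by simp [sq])
  by_cases hgm : g ≤ m
  · calc (s.card : ℝ) ≤ ∑ e ∈ Finset.Ioc g m, (((m / e : ℕ) : ℝ)) ^ 2 := by exact_mod_cast h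
      _ ≤ ∑ e ∈ Finset.Ioc g m, (m : ℝ) ^ 2 * ((e : ℝ) ^ 2)⁻¹ := by
        refine Finset.sum_le_sum fun e _ => ?_
        rw [← div_eq_mul_inv, ← div_pow]
        gcongr
        exact Nat.cast_div_le
      _ = (m : ℝ) ^ 2 * ∑ e ∈ Finset.Ioc g m, ((e : ℝ) ^ 2)⁻¹ := by rw [Finset.mul_sum]
      _ ≤ (m : ℝ) ^ 2 * ((g : ℝ)⁻¹ - (m : ℝ)⁻¹) := by
        gcongr
        exact sum_Ioc_inv_sq_le_sub hg.ne' hgm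
      _ ≤ (m : ℝ) ^ 2 / g := by
        rw [div_eq_mul_inv]
        gcongr
        have : (0 : ℝ) ≤ (m : ℝ)⁻¹ := by positivity
        linarith
  · rw [Finset.Ioc_eq_empty (by omega), Finset.sum_empty] at h
    rw [Nat.le_zero.1 h]
    simp only [Nat.cast_zero]
    positivity

theorem IsUniformUpTo.le_sum_ultPeriod {Ω F : Type} [Fintype Ω] [Fintype F] [Nonempty F]
    {φ : Ω → F → F} {d : ℕ} (hφ : IsUniformUpTo φ d) {N m : ℕ} (hN : 1 ≤ N)
    (hm : 2 * N ^ 4 ≤ m) (hmd : 2 * m ≤ d) (hmq : N * m ^ 2 ≤ Fintype.card F) :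
    (Fintype.card Ω : ℝ) * (m * (1 - 3 / N) - 2 * N ^ 4) ≤ ∑ ω, (ultPeriod (φ ω) : ℝ) := by
  set K := Finset.Ioc (m / N) m with hK
  set R := (K ×ˢ K).filter fun p => N ^ 2 < p.1.gcd p.2 with hR
  have hN0 : (0 : ℝ) < N := by exact_mod_cast hN
  have hN4 : 1 ≤ N ^ 4 := Nat.one_le_pow _ _ hN
  have hm0 : (0 : ℝ) < m := by exact_mod_cast (by omega : 0 < m)
  have hq0 : (0 : ℝ) < Fintype.card F := by exact_mod_cast Fintype.card_pos
  have hKpos : ∀ k ∈ K, 0 < k ∧ k ≤ m := fun k hk =>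
    ⟨pos_of_gt (Finset.mem_Ioc.1 hk).1, (Finset.mem_Ioc.1 hk).2⟩
  have hKK : ∀ p ∈ K ×ˢ K, 0 < p.1 ∧ 0 < p.2 ∧ p.1 + p.2 ≤ d := fun p hp => by
    have h1 := hKpos _ (Finset.mem_product.1 hp).1
    have h2 := hKpos _ (Finset.mem_product.1 hp).2
    omega
  have hX := hφ.le_sum_card_pointsWithPeriod hKpos (by omega)
    (le_trans (by nlinarith [Nat.zero_le m, Nat.zero_le (N * m ^ 2)]) hmq)
  have hY : ∑ ω, ((separatedPairs (φ ω) R).card : ℝ) ≤ R.card * Fintype.card Ω := by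
    exact_mod_cast hφ.sum_card_separatedPairs_le R fun p hp => hKK p (Finset.mem_filter.1 hp).1
  have hZ : ∑ ω, ((separatedPairs (φ ω) (K ×ˢ K)).card : ℝ) ≤
      (K ×ˢ K).card * Fintype.card Ω := by
    exact_mod_cast hφ.sum_card_separatedPairs_le _ hKK
  have hRcard : (R.card : ℝ) ≤ (m : ℝ) ^ 2 / (N ^ 2 : ℕ) :=
    card_filter_lt_gcd_le (by positivity) m R (Finset.filter_subset_filter _
      (Finset.product_subset_product (Finset.Ioc_subset_Ioc_left (Nat.zero_le _))
        (Finset.Ioc_subset_Ioc_left (Nat.zero_le _))))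
  have hKcard : ((K ×ˢ K).card : ℝ) ≤ (m : ℝ) ^ 2 := by
    have : (K ×ˢ K).card ≤ m ^ 2 := by
      rw [Finset.card_product, sq, hK, Nat.card_Ioc]
      exact Nat.mul_le_mul (Nat.sub_le _ _) (Nat.sub_le _ _)
    exact_mod_cast this
  have hKcard' : (m : ℝ) * (1 - 1 / N) ≤ K.card := by
    rw [hK, Nat.card_Ioc, Nat.cast_sub (Nat.div_le_self _ _)]
    have : ((m / N : ℕ) : ℝ) ≤ m / N := Nat.cast_div_le
    have h2 : (m : ℝ) * (1 - 1 / N) = m - m / N := by ring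
    linarith
  have hmq' : (m : ℝ) ^ 2 / Fintype.card F ≤ 1 / N := by
    rw [div_le_div_iff₀ hq0 hN0]
    have : (N : ℝ) * m ^ 2 ≤ Fintype.card F := by exact_mod_cast hmq
    linarith
  have hN1 : (1 : ℝ) / N ≤ 1 := by
    rw [div_le_one hN0]
    exact_mod_cast hN
  have hXm : (m : ℝ) * (1 - 2 / N) ≤ K.card * (1 - (m : ℝ) ^ 2 / Fintype.card F) :=
    calc (m : ℝ) * (1 - 2 / N) ≤ m * (1 - 1 / N) * (1 - 1 / N) := by
          have : (m : ℝ) * (1 - 1 / N) * (1 - 1 / N) - m * (1 - 2 / N) = m * (1 / N) ^ 2 := by ring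
          have : 0 ≤ (m : ℝ) * (1 / N) ^ 2 := by positivity
          linarith
      _ ≤ _ := mul_le_mul hKcard' (by linarith) (by linarith) (by positivity)
  have hYm : (N / m : ℝ) * (R.card * Fintype.card Ω) ≤ Fintype.card Ω * (m / N) :=
    calc (N / m : ℝ) * (R.card * Fintype.card Ω)
        ≤ (N / m : ℝ) * ((m : ℝ) ^ 2 / (N ^ 2 : ℕ) * Fintype.card Ω) := by gcongr
      _ = _ := by push_cast; field_simp
  have hZm : (2 * N ^ 4 / m ^ 2 : ℝ) * ((K ×ˢ K).card * Fintype.card Ω) ≤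
      Fintype.card Ω * (2 * N ^ 4) :=
    calc (2 * N ^ 4 / m ^ 2 : ℝ) * ((K ×ˢ K).card * Fintype.card Ω)
        ≤ (2 * N ^ 4 / m ^ 2 : ℝ) * ((m : ℝ) ^ 2 * Fintype.card Ω) := by gcongr
      _ = _ := by field_simp
  have hsum : ∑ ω, ((pointsWithPeriod (φ ω) K).card : ℝ) ≤ ∑ ω, (ultPeriod (φ ω) : ℝ) +
      (N / m : ℝ) * ∑ ω, ((separatedPairs (φ ω) R).card : ℝ) +
      (2 * N ^ 4 / m ^ 2 : ℝ) * ∑ ω, ((separatedPairs (φ ω) (K ×ˢ K)).card : ℝ) := by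
    rw [Finset.mul_sum, Finset.mul_sum, ← Finset.sum_add_distrib, ← Finset.sum_add_distrib]
    exact Finset.sum_le_sum fun ω _ => card_pointsWithPeriod_le (φ ω) hN hm
  have hY' := mul_le_mul_of_nonneg_left hY (by positivity : (0 : ℝ) ≤ N / m)
  have hZ' := mul_le_mul_of_nonneg_left hZ (by positivity : (0 : ℝ) ≤ 2 * N ^ 4 / m ^ 2)
  have hX' := mul_le_mul_of_nonneg_left hXm (Nat.cast_nonneg (α := ℝ) (Fintype.card Ω))
  have : (Fintype.card Ω : ℝ) * (m * (1 - 3 / N) - 2 * N ^ 4) =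
      Fintype.card Ω * (m * (1 - 2 / N)) - Fintype.card Ω * (m / N) -
        Fintype.card Ω * (2 * N ^ 4) := by ring
  linarith

instance finite_degree_eq (F : Type) [Field F] [Fintype F] (d : ℕ) :
    Finite {f : Polynomial F // f.degree = (d : WithBot ℕ)} := by
  have : Finite (degreeLT F (d + 1)) := Finite.of_equiv _ (degreeLTEquiv F (d + 1)).toEquiv.symm
  refine Finite.of_injective (β := degreeLT F (d + 1)) (fun f => ⟨f.1, ?_⟩) fun f g h => ?_
  · rw [mem_degreeLT, f.2]
    exact_mod_cast Nat.lt_succ_self d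
  · exact Subtype.ext (Subtype.mk.inj h)

theorem card_degree_eq (F : Type) [Field F] [Fintype F] (d : ℕ) :
    (Nat.card {f : Polynomial F // f.degree = (d : WithBot ℕ)} : ℝ) =
      (Fintype.card F : ℝ) ^ d * ((Fintype.card F : ℝ) - 1) := by
  classical
  have hcard : ∀ n, Nat.card (degreeLT F n) = Fintype.card F ^ n := fun n => by
    rw [Nat.card_congr (degreeLTEquiv F n).toEquiv]; simp
  have hfin : ∀ n, Finite (degreeLT F n) := fun n =>
    Finite.of_equiv _ (degreeLTEquiv F n).toEquiv.symm
  have e : degreeLT F (d + 1) ≃ degreeLT F d ⊕ {f : Polynomial F // f.degree = (d : WithBot ℕ)} :=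
    (Equiv.subtypeEquivRight (q := fun f : Polynomial F => f ∈ degreeLT F d ∨
        f.degree = (d : WithBot ℕ)) fun f => by
      rw [mem_degreeLT, mem_degreeLT, ← le_iff_lt_or_eq]
      cases f.degree with
      | bot => simp
      | coe n => exact WithBot.coe_lt_coe.trans (Nat.lt_succ_iff.trans WithBot.coe_le_coe.symm)).trans
    (subtypeOrEquiv _ _ (by
      rw [Pi.disjoint_iff]
      intro f
      rw [Prop.disjoint_iff, mem_degreeLT]
      by_contra! h
      exact h.1.ne h.2))
  have h := Nat.card_congr e
  rw [Nat.card_sum, hcard, hcard] at h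
  have h' : (Fintype.card F : ℝ) ^ (d + 1) = (Fintype.card F : ℝ) ^ d +
    Nat.card {f : Polynomial F // f.degree = (d : WithBot ℕ)} := by exact_mod_cast h
  rw [pow_succ] at h'
  linarith

theorem isUniformUpTo_degree_eq (F : Type) [Field F] [Fintype F] (d : ℕ)
    [Fintype {f : Polynomial F // f.degree = (d : WithBot ℕ)}] :
    IsUniformUpTo (fun (f : {f : Polynomial F // f.degree = (d : WithBot ℕ)}) x => f.val.eval x)
      d := by
  classical
  intro ι _ w v hι
  have hfiber : ∀ v' : ι → F,
      Nat.card {f : {f : Polynomial F // f.degree = (d : WithBot ℕ)} //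
        ∀ i, f.val.eval (w i) = v' i} =
      Nat.card {f : {f : Polynomial F // f.degree = (d : WithBot ℕ)} //
        ∀ i, f.val.eval (w i) = v i} := by
    have hle : ∀ v₁ v₂ : ι → F,
        Nat.card {f : {f : Polynomial F // f.degree = (d : WithBot ℕ)} //
          ∀ i, f.val.eval (w i) = v₁ i} ≤
        Nat.card {f : {f : Polynomial F // f.degree = (d : WithBot ℕ)} //
          ∀ i, f.val.eval (w i) = v₂ i} := by
      intro v₁ v₂
      have hdeg : (Lagrange.interpolate Finset.univ w (v₂ - v₁)).degree < (d : WithBot ℕ) :=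
        (Lagrange.degree_interpolate_lt _ w.injective.injOn).trans_le (by exact_mod_cast hι)
      refine Nat.card_le_card_of_injective (fun f => ⟨⟨f.1.1 +
        Lagrange.interpolate Finset.univ w (v₂ - v₁), ?_⟩, fun i => ?_⟩) fun f g h => ?_
      · rw [degree_add_eq_left_of_degree_lt (by rwa [f.1.2]), f.1.2]
      · rw [eval_add, f.2, Lagrange.eval_interpolate_at_node _ w.injective.injOn
          (Finset.mem_univ i)]
        simp
      · simp only [Subtype.mk.injEq, add_left_inj] at h
        exact Subtype.ext (Subtype.ext h)
    exact fun v' => le_antisymm (hle _ _) (hle _ _)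
  rw [← Nat.card_eq_fintype_card (α := {f : Polynomial F // f.degree = (d : WithBot ℕ)}),
    ← Nat.card_congr (Equiv.sigmaFiberEquiv
    fun (f : {f : Polynomial F // f.degree = (d : WithBot ℕ)}) (i : ι) => f.val.eval (w i)),
    Nat.card_sigma, Finset.sum_congr rfl fun v' _ =>
      (Nat.card_congr (Equiv.subtypeEquivRight fun f => funext_iff)).trans (hfiber v')]
  rw [Finset.sum_const, Finset.card_univ, Fintype.card_fun, smul_eq_mul, mul_comm]

/-- If `d = d(q) → ∞` with `d = o(√q)`, then the average period of a
degree-`d` polynomial satisfies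
`(1/(q^d(q-1))) ∑_{f ∈ Ω(q,d)} T(f) ≥ (1 + o(1)) d/2`: for every `ε > 0` there are `D`
and `δ > 0` such that for every finite field `F` with `q` elements and every `d` with
`D ≤ d` and `d ≤ δ√q`, the average is at least `(1-ε) d/2`. -/
theorem stmt9 (ε : ℝ) (hε : 0 < ε) :
    ∃ (D : ℕ) (δ : ℝ), 0 < δ ∧ ∀ (F : Type) [Field F] [Fintype F], ∀ d : ℕ,
      D ≤ d → (d : ℝ) ≤ δ * Real.sqrt (Fintype.card F) →
      (1 / ((Fintype.card F : ℝ) ^ d * ((Fintype.card F : ℝ) - 1))) *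
          (∑ᶠ f : {f : Polynomial F // f.degree = (d : WithBot ℕ)},
            (ultPeriod (fun x => f.val.eval x) : ℝ)) ≥
        (1 - ε) * (d : ℝ) / 2 := by
  obtain ⟨N, hNε⟩ := exists_nat_ge (max 4 (4 / ε))
  have hN4 : (4 : ℝ) ≤ N := (le_max_left _ _).trans hNε
  have hN0 : (0 : ℝ) < N := by linarith
  have hN : 1 ≤ N := by
    have : 4 ≤ N := by exact_mod_cast hN4
    omega
  have hεN : 4 / N ≤ ε := by
    have := (le_max_right _ _).trans hNε
    rw [div_le_iff₀ hε] at this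
    rw [div_le_iff₀ hN0]
    linarith
  refine ⟨2 * N + 4 * N ^ 5 + 4 * N ^ 4 + 1, 1 / N, by positivity, fun F _ _ d hD hd => ?_⟩
  let _ := Fintype.ofFinite {f : Polynomial F // f.degree = (d : WithBot ℕ)}
  have hq : (1 : ℝ) < Fintype.card F := by exact_mod_cast Fintype.one_lt_card
  have hpos : 0 < (Fintype.card F : ℝ) ^ d * ((Fintype.card F : ℝ) - 1) :=
    mul_pos (by positivity) (by linarith)
  have hdq : (N : ℝ) ^ 2 * d ^ 2 ≤ Fintype.card F := by
    have h1 : (N : ℝ) * d ≤ Real.sqrt (Fintype.card F) := by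
      have := mul_le_mul_of_nonneg_left hd hN0.le
      rwa [← mul_assoc, mul_one_div_cancel hN0.ne', one_mul] at this
    rw [← mul_pow, ← Real.sq_sqrt (by linarith : (0 : ℝ) ≤ Fintype.card F)]
    gcongr
  have hmq : N * (d / 2) ^ 2 ≤ Fintype.card F :=
    calc N * (d / 2) ^ 2 ≤ N ^ 2 * d ^ 2 :=
          Nat.mul_le_mul (Nat.le_self_pow two_ne_zero N)
            (Nat.pow_le_pow_left (Nat.div_le_self _ _) 2)
      _ ≤ _ := by exact_mod_cast hdq
  have h := (isUniformUpTo_degree_eq F d).le_sum_ultPeriod hN (m := d / 2)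
    (by generalize N ^ 4 = a at *; generalize N ^ 5 = b at *; omega) (by omega) hmq
  rw [← Nat.card_eq_fintype_card, card_degree_eq] at h
  rw [finsum_eq_sum_of_fintype, ge_iff_le, one_div, inv_mul_eq_div, le_div_iff₀ hpos, mul_comm]
  refine le_trans (mul_le_mul_of_nonneg_left ?_ hpos.le) h
  have hm : ((d : ℝ) - 1) / 2 ≤ ((d / 2 : ℕ) : ℝ) := by
    have : d ≤ 2 * (d / 2) + 1 := by omega
    have : (d : ℝ) ≤ 2 * ((d / 2 : ℕ) : ℝ) + 1 := by exact_mod_cast this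
    linarith
  have h3 : (3 : ℝ) / N ≤ 1 := by
    rw [div_le_one hN0]
    linarith
  have h3' : (0 : ℝ) ≤ 3 / N := by positivity
  have hDN : 1 + 2 * (N : ℝ) ^ 4 ≤ d / (2 * N) := by
    have : (2 * N + 4 * N ^ 5 : ℝ) ≤ d := by
      exact_mod_cast (by omega : 2 * N + 4 * N ^ 5 ≤ d)
    rw [le_div_iff₀ (by positivity)]
    nlinarith
  calc (1 - ε) * d / 2 ≤ (1 - 4 / N) * d / 2 := by gcongr
    _ = ((d : ℝ) / 2) * (1 - 3 / N) - d / (2 * N) := by field_simp; ring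
    _ ≤ ((d : ℝ) - 1) / 2 * (1 - 3 / N) - 2 * N ^ 4 := by nlinarith
    _ ≤ _ := by
      have := mul_le_mul_of_nonneg_right hm (by linarith : (0 : ℝ) ≤ 1 - 3 / N)
      linarith
end

section
/- For every ε > 0 there exist an integer D and a real δ > 0 such that for every finite field F with q elements and every integer d with d ≥ D and d ≤ δ·√q, the proportion of polynomials f ∈ Ω(q,d) having no cycle whose length k satisfies √(d/2) ≤ k ≤ d/2 is at most ε. (That is, if d = d(q) → ∞ with d = o(√q), then all but o(q^d(q−1)) polynomials in Ω(q,d) have at least one cycle with length in the interval [√(d/2), d/2].) -/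
open Polynomial

/-- The uniform probability measure on the `q^d (q-1)` polynomials of degree exactly `d`
over `F`, evaluated on the event `P`. -/
noncomputable def polyProb (F : Type*) [Field F] [Fintype F] (d : ℕ)
    (P : Polynomial F → Prop) : ℝ :=
  (Nat.card {f : Polynomial F | f.degree = (d : WithBot ℕ) ∧ P f} : ℝ) /
    ((Fintype.card F : ℝ) ^ d * ((Fintype.card F : ℝ) - 1))

theorem ncard_degree_eq (F : Type*) [Field F] [Fintype F] (e : ℕ) :
    {f : F[X] | f.degree = e}.Finite ∧
      {f : F[X] | f.degree = e}.ncard = Fintype.card F ^ e * (Fintype.card F - 1) := by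
  have hfin (n : ℕ) : (degreeLT F n : Set F[X]).Finite :=
    Set.finite_coe_iff.1 (Finite.of_equiv (Fin n → F) (degreeLTEquiv F n).toEquiv.symm)
  have hcard (n : ℕ) : (degreeLT F n : Set F[X]).ncard = Fintype.card F ^ n := by
    rw [← Nat.card_coe_set_eq]
    refine (Nat.card_congr (degreeLTEquiv F n).toEquiv).trans ?_
    simp
  have hset : {f : F[X] | f.degree = e} = (degreeLT F (e + 1) : Set F[X]) \ degreeLT F e := by
    ext f
    simp only [Set.mem_ofPred_eq, Set.mem_sdiff, SetLike.mem_coe, mem_degreeLT]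
    rcases eq_or_ne f 0 with rfl | hf
    · simp
    · rw [degree_eq_natDegree hf]
      norm_cast
      omega
  refine ⟨hset ▸ (hfin _).sdiff, ?_⟩
  rw [hset, Set.ncard_sdiff (by exact_mod_cast degreeLT_mono e.le_succ) (hfin e), hcard, hcard,
    pow_succ, Nat.mul_sub_one]

theorem ncard_degree_eq_and_eval_eq {F : Type*} [Field F] [Fintype F] {d : ℕ} (s : Finset F)
    (hs : s.card ≤ d) (v : F → F) :
    {f : F[X] | f.degree = d ∧ ∀ x ∈ s, f.eval x = v x}.ncard =
      Fintype.card F ^ (d - s.card) * (Fintype.card F - 1) := by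
  classical
  set P := Lagrange.interpolate s id v
  have hP : P.degree < s.card := Lagrange.degree_interpolate_lt v (Set.injOn_id _)
  have hPev : ∀ x ∈ s, P.eval x = v x := fun x hx =>
    Lagrange.eval_interpolate_at_node v (Set.injOn_id _) hx
  set N := Lagrange.nodal s (id : F → F)
  have hN : N ≠ 0 := Lagrange.nodal_ne_zero
  have hNdeg : N.degree = s.card := Lagrange.degree_nodal
  have hPd : P.degree < (d : WithBot ℕ) := hP.trans_le (by exact_mod_cast hs)
  rw [← (ncard_degree_eq F (d - s.card)).2]
  symm
  refine Set.ncard_congr (fun h _ => N * h + P) ?_ ?_ ?_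
  · intro h hh
    have hmul : (N * h).degree = d := by
      rw [degree_mul, hNdeg, show h.degree = _ from hh]
      norm_cast
      omega
    refine ⟨?_, fun x hx => ?_⟩
    · rw [degree_add_eq_left_of_degree_lt (by rwa [hmul]), hmul]
    · have : N.eval x = 0 := Lagrange.eval_nodal_at_node (v := id) hx
      simp [this, hPev x hx]
  · intro a b _ _ hab
    exact mul_left_cancel₀ hN (add_right_cancel hab)
  · rintro f ⟨hf, hfv⟩
    have hdvd : N ∣ f - P := by
      rw [show N = ∏ x ∈ s, (X - C x) from rfl]
      refine Finset.prod_dvd_of_coprime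
        (fun x _ y _ hxy => pairwise_coprime_X_sub_C Function.injective_id hxy) fun x hx => ?_
      rw [dvd_iff_isRoot, IsRoot, eval_sub, hfv x hx, hPev x hx, sub_self]
    obtain ⟨h, hh⟩ := hdvd
    refine ⟨h, ?_, by rw [← hh]; ring⟩
    have hdeg : (N * h).degree = d := by
      rw [← hh, degree_sub_eq_left_of_degree_lt (by rwa [hf]), hf]
    rw [degree_mul, hNdeg] at hdeg
    have hh0 : h ≠ 0 := by
      rintro rfl
      simp at hdeg
    rw [degree_eq_natDegree hh0] at hdeg
    show h.degree = _
    rw [degree_eq_natDegree hh0]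
    norm_cast at hdeg ⊢
    omega

theorem val_finRotate {k : ℕ} (i : Fin k) : (finRotate k i : ℕ) = (i + 1) % k := by
  obtain _ | k := k
  · exact i.elim0
  · rw [finRotate_apply, Fin.val_add, Fin.val_one', Nat.add_mod_mod]

theorem iterate_finRotate {α : Type*} {g : α → α} {x : α} {k : ℕ}
    (hx : Function.minimalPeriod g x = k) (i : Fin k) :
    g (g^[i] x) = g^[(finRotate k i : Fin k)] x := by
  have h := Function.iterate_mod_minimalPeriod_eq (f := g) (x := x) (n := i + 1)
  rw [val_finRotate, ← Function.iterate_succ_apply' g, ← h, hx]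

/-- The embedding of `Fin k` onto the orbit of a point of minimal period `k`. -/
def cycleEmbedding {α : Type*} (g : α → α) (x : α) {k : ℕ}
    (hx : Function.minimalPeriod g x = k) : Fin k ↪ α where
  toFun i := g^[i] x
  inj' i j hij := Fin.ext <| Function.iterate_injOn_Iio_minimalPeriod
    (by simp [hx]) (by simp [hx]) hij

theorem apply_eq_iterate_of_apply_finRotate {α : Type*} {g : α → α} {k : ℕ} (hk : 0 < k)
    {c : Fin k ↪ α} (hc : ∀ i, g (c i) = c (finRotate k i)) (n : ℕ) :
    g^[n] (c ⟨0, hk⟩) = c ⟨n % k, Nat.mod_lt _ hk⟩ := by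
  induction n with
  | zero => simp
  | succ n ih =>
    rw [Function.iterate_succ_apply', ih, hc]
    exact congrArg c (Fin.ext (by rw [val_finRotate, Nat.mod_add_mod]))

theorem minimalPeriod_of_apply_finRotate {α : Type*} {g : α → α} {k : ℕ} (hk : 0 < k)
    {c : Fin k ↪ α} (hc : ∀ i, g (c i) = c (finRotate k i)) :
    Function.minimalPeriod g (c ⟨0, hk⟩) = k := by
  have hper (n : ℕ) : Function.IsPeriodicPt g n (c ⟨0, hk⟩) ↔ k ∣ n := by
    rw [Function.IsPeriodicPt, Function.IsFixedPt, apply_eq_iterate_of_apply_finRotate hk hc,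
      c.injective.eq_iff, Fin.mk.injEq, Nat.dvd_iff_mod_eq_zero]
  refine Nat.dvd_antisymm ?_ ?_
  · exact Function.IsPeriodicPt.minimalPeriod_dvd ((hper k).2 dvd_rfl)
  · exact (hper _).1 (Function.isPeriodicPt_minimalPeriod _ _)

open Classical in
theorem card_minimalPeriod_eq {α : Type*} [Fintype α] (g : α → α) {k : ℕ} (hk : 0 < k) :
    Finset.card {x | Function.minimalPeriod g x = k} =
      Finset.card {c : Fin k ↪ α | ∀ i, g (c i) = c (finRotate k i)} := by
  refine Finset.card_bij' (fun x hx => cycleEmbedding g x (by simpa using hx))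
    (fun c _ => c ⟨0, hk⟩) ?_ ?_ ?_ ?_
  · intro x hx
    simp only [Finset.mem_filter_univ] at hx ⊢
    exact iterate_finRotate hx
  · intro c hc
    simp only [Finset.mem_filter_univ] at hc ⊢
    exact minimalPeriod_of_apply_finRotate hk hc
  · intro x hx
    rfl
  · intro c hc
    simp only [Finset.mem_filter_univ] at hc
    ext i
    refine (apply_eq_iterate_of_apply_finRotate hk hc i).trans ?_
    simp [Nat.mod_eq_of_lt i.2]

open Classical in
theorem card_minimalPeriod_mul_card_minimalPeriod_le {α : Type*} [Fintype α] (g : α → α)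
    {j k : ℕ} (hj : 0 < j) (hk : 0 < k) :
    Finset.card {x | Function.minimalPeriod g x = j} *
        Finset.card {x | Function.minimalPeriod g x = k} ≤
      Finset.card {c : Fin j ⊕ Fin k ↪ α |
        ∀ i, g (c i) = c (Sum.map (finRotate j) (finRotate k) i)} +
      if j = k then k * Finset.card {x | Function.minimalPeriod g x = k} else 0 := by
  have hmeet {x y : α} (hx : Function.minimalPeriod g x = j)
      (hy : Function.minimalPeriod g y = k) {m n : ℕ} (h : g^[m] x = g^[n] y) :
      j = k ∧ ∃ r : Fin k, g^[r] x = y := by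
    have hxp : x ∈ Function.periodicPts g :=
      Function.minimalPeriod_pos_iff_mem_periodicPts.1 (hx ▸ hj)
    have hyp : y ∈ Function.periodicPts g :=
      Function.minimalPeriod_pos_iff_mem_periodicPts.1 (hy ▸ hk)
    have hjk : j = k := by
      rw [← hx, ← hy, ← Function.minimalPeriod_apply_iterate hxp m, h,
        Function.minimalPeriod_apply_iterate hyp]
    refine ⟨hjk, ⟨(n * (k - 1) + m) % k, Nat.mod_lt _ hk⟩, ?_⟩
    have hx' : Function.minimalPeriod g x = k := hx.trans hjk
    show g^[(n * (k - 1) + m) % k] x = y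
    rw [← hx', Function.iterate_mod_minimalPeriod_eq, hx', Function.iterate_add_apply, h,
      ← Function.iterate_add_apply, ← Nat.mul_add_one, Nat.sub_add_cancel hk,
      ← Function.iterate_mod_minimalPeriod_eq, hy]
    simp
  rw [← Finset.card_product,
    ← Finset.card_filter_add_card_filter_not (fun p : α × α => ∃ m n, g^[m] p.1 = g^[n] p.2), add_comm]
  refine add_le_add ?_ ?_
  · let e : α × α → (Fin j ⊕ Fin k → α) :=
      fun p => Sum.elim (fun i => g^[i] p.1) (fun i => g^[i] p.2)
    rw [← Finset.card_map ⟨_, (DFunLike.coe_injective : Function.Injective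
      (fun (c : Fin j ⊕ Fin k ↪ α) => (c : Fin j ⊕ Fin k → α)))⟩]
    refine Finset.card_le_card_of_injOn e ?_ ?_
    · rintro ⟨x, y⟩ hxy
      simp only [Finset.coe_filter, Finset.mem_product, Finset.mem_filter_univ,
        Set.mem_ofPred_eq, not_exists] at hxy
      obtain ⟨⟨hx, hy⟩, hne⟩ := hxy
      have he : Function.Injective (e (x, y)) :=
        (cycleEmbedding g x hx).injective.sumElim (cycleEmbedding g y hy).injective
          fun _ _ => hne _ _
      simp only [Finset.coe_map, Function.Embedding.coeFn_mk, Set.mem_image, Finset.mem_coe,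
        Finset.mem_filter_univ]
      refine ⟨⟨_, he⟩, ?_, rfl⟩
      rintro (i | i)
      · exact iterate_finRotate hx i
      · exact iterate_finRotate hy i
    · rintro ⟨x, y⟩ - ⟨x', y'⟩ - h
      exact Prod.ext (congrFun h (.inl ⟨0, hj⟩)) (congrFun h (.inr ⟨0, hk⟩))
  · split_ifs with hjk
    · subst hjk
      calc _ ≤ ((Finset.univ : Finset (Fin j)) ×ˢ
            ({x | Function.minimalPeriod g x = j} : Finset α)).card := by
            refine Finset.card_le_card_of_surjOn (fun p => (p.2, g^[p.1] p.2)) ?_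
            rintro ⟨x, y⟩ hxy
            simp only [Finset.coe_filter, Finset.mem_product, Finset.mem_filter_univ,
              Set.mem_ofPred_eq] at hxy
            obtain ⟨⟨hx, hy⟩, m, n, h⟩ := hxy
            obtain ⟨-, r, hr⟩ := hmeet hx hy h
            exact ⟨(r, x), by simpa using hx, Prod.ext rfl hr⟩
        _ = _ := by rw [Finset.card_product, Finset.card_fin]
    · rw [Nat.le_zero, Finset.card_eq_zero, Finset.filter_eq_empty_iff]
      rintro ⟨x, y⟩ hxy ⟨m, n, h⟩
      simp only [Finset.mem_product, Finset.mem_filter_univ] at hxy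
      exact hjk (hmeet hxy.1 hxy.2 h).1

theorem card_eq_zero_mul_sq_le {β : Type*} (Ω : Finset β) (K : Finset ℕ) (hK : ∀ k ∈ K, 0 < k)
    (N : β → ℕ → ℝ) (η : ℝ)
    (hupper : ∀ k ∈ K, ∑ f ∈ Ω, N f k ≤ Ω.card)
    (hlower : ∀ k ∈ K, (1 - η) * Ω.card ≤ ∑ f ∈ Ω, N f k)
    (hpair : ∀ j ∈ K, ∀ k ∈ K, ∑ f ∈ Ω, N f j * N f k ≤
      Ω.card + if j = k then (k : ℝ) * ∑ f ∈ Ω, N f k else 0) {B : Finset β} (hB : B ⊆ Ω)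
    (hBN : ∀ f ∈ B, ∀ k ∈ K, N f k = 0) :
    B.card * (∑ k ∈ K, (k : ℝ)⁻¹) ^ 2 ≤
      (∑ k ∈ K, (k : ℝ)⁻¹ + 2 * η * (∑ k ∈ K, (k : ℝ)⁻¹) ^ 2) * Ω.card := by
  set H := ∑ k ∈ K, (k : ℝ)⁻¹ with hH
  have hH0 : 0 ≤ H := Finset.sum_nonneg fun k _ => by positivity
  set X : β → ℝ := fun f => ∑ k ∈ K, (k : ℝ)⁻¹ * N f k with hX
  have hfirst : H * ((1 - η) * Ω.card) ≤ ∑ f ∈ Ω, X f := by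
    rw [hX, Finset.sum_comm, hH, Finset.sum_mul]
    refine Finset.sum_le_sum fun k hk => ?_
    rw [← Finset.mul_sum]
    gcongr
    exact hlower k hk
  have hsecond : ∑ f ∈ Ω, X f ^ 2 ≤ (H ^ 2 + H) * Ω.card := by
    have hexp : ∑ f ∈ Ω, X f ^ 2 =
        ∑ j ∈ K, ∑ k ∈ K, (j : ℝ)⁻¹ * (k : ℝ)⁻¹ * ∑ f ∈ Ω, N f j * N f k := by
      simp_rw [hX, sq, Finset.sum_mul_sum, Finset.mul_sum]
      rw [Finset.sum_comm]
      refine Finset.sum_congr rfl fun j _ => ?_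
      rw [Finset.sum_comm]
      refine Finset.sum_congr rfl fun k _ => Finset.sum_congr rfl fun f _ => by ring
    calc ∑ f ∈ Ω, X f ^ 2
        ≤ ∑ j ∈ K, ∑ k ∈ K, ((j : ℝ)⁻¹ * (k : ℝ)⁻¹ * Ω.card +
            if j = k then (k : ℝ)⁻¹ * Ω.card else 0) := by
          rw [hexp]
          refine Finset.sum_le_sum fun j hj => Finset.sum_le_sum fun k hk => ?_
          calc (j : ℝ)⁻¹ * (k : ℝ)⁻¹ * ∑ f ∈ Ω, N f j * N f k
              ≤ (j : ℝ)⁻¹ * (k : ℝ)⁻¹ *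
                (Ω.card + if j = k then (k : ℝ) * ∑ f ∈ Ω, N f k else 0) := by
                gcongr
                exact hpair j hj k hk
            _ ≤ _ := by
                rw [mul_add]
                gcongr
                split_ifs with hjk
                · have : (k : ℝ) ≠ 0 := by exact_mod_cast (hK k hk).ne'
                  rw [hjk, mul_assoc, inv_mul_cancel_left₀ this]
                  gcongr
                  exact hupper k hk
                · simp
      _ = (H ^ 2 + H) * Ω.card := by
          simp_rw [Finset.sum_add_distrib, ← Finset.sum_mul, ← Finset.mul_sum, ← Finset.sum_mul]
          rw [← hH, add_mul, sq, hH, Finset.sum_mul K (fun k => (k : ℝ)⁻¹) (Ω.card : ℝ)]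
          congr 1
          exact Finset.sum_congr rfl fun j hj => by rw [Finset.sum_ite_eq, if_pos hj]
  calc B.card * H ^ 2 = ∑ f ∈ B, (X f - H) ^ 2 := by
        rw [← nsmul_eq_mul, ← Finset.sum_const]
        refine Finset.sum_congr rfl fun f hf => ?_
        rw [hX]
        simp only
        rw [Finset.sum_eq_zero fun k hk => by rw [hBN f hf k hk, mul_zero], zero_sub, neg_sq]
    _ ≤ ∑ f ∈ Ω, (X f - H) ^ 2 :=
        Finset.sum_le_sum_of_subset_of_nonneg hB fun _ _ _ => sq_nonneg _
    _ = ∑ f ∈ Ω, X f ^ 2 - 2 * H * ∑ f ∈ Ω, X f + Ω.card * H ^ 2 := by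
        simp_rw [sub_sq, Finset.sum_add_distrib, Finset.sum_sub_distrib, Finset.sum_const,
          nsmul_eq_mul, Finset.mul_sum]
        congr 2
        exact Finset.sum_congr rfl fun f _ => by ring
    _ ≤ (H + 2 * η * H ^ 2) * Ω.card := by nlinarith

theorem pow_mul_one_sub_le_descFactorial {q : ℕ} (hq : 0 < q) (k : ℕ) :
    (q : ℝ) ^ k * (1 - (k : ℝ) ^ 2 / q) ≤ q.descFactorial k := by
  have hq' : (0 : ℝ) < q := by exact_mod_cast hq
  induction k with
  | zero => simp
  | succ k ih =>
    rcases le_or_gt q k with hqk | hqk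
    · refine le_trans (mul_nonpos_of_nonneg_of_nonpos (by positivity) ?_) (Nat.cast_nonneg _)
      rw [sub_nonpos, one_le_div hq']
      have : (q : ℝ) ≤ k := by exact_mod_cast hqk
      push_cast
      nlinarith
    · have hle : (k : ℝ) ≤ q := by exact_mod_cast hqk.le
      rw [Nat.descFactorial_succ, Nat.cast_mul, Nat.cast_sub hqk.le]
      refine le_trans ?_ (mul_le_mul_of_nonneg_left ih (sub_nonneg.2 hle))
      have : (q : ℝ) * (1 - ((k + 1 : ℕ) : ℝ) ^ 2 / q) ≤ (q - k) * (1 - (k : ℝ) ^ 2 / q) := by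
        rw [← sub_nonneg]
        have : (q - k) * (1 - (k : ℝ) ^ 2 / q) - (q : ℝ) * (1 - ((k + 1 : ℕ) : ℝ) ^ 2 / q) =
            (k + 1) + k ^ 3 / q := by
          field_simp
          push_cast
          ring
        rw [this]
        positivity
      calc _ = (q : ℝ) ^ k * (q * (1 - ((k + 1 : ℕ) : ℝ) ^ 2 / q)) := by ring
        _ ≤ (q : ℝ) ^ k * ((q - k) * (1 - (k : ℝ) ^ 2 / q)) := by gcongr
        _ = _ := by ring

theorem log_div_le_sum_Icc_inv {a b : ℕ} (ha : 0 < a) (hab : a ≤ b + 1) :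
    Real.log ((b + 1) / a) ≤ ∑ k ∈ Finset.Icc a b, (k : ℝ)⁻¹ := by
  have ha' : (a : ℝ) ≠ 0 := by positivity
  rw [Real.log_div (by positivity) ha', ← Nat.cast_succ,
    ← Finset.sum_Ico_sub (fun k : ℕ => Real.log k) hab, Finset.Ico_add_one_right_eq_Icc]
  refine Finset.sum_le_sum fun k hk => ?_
  have hk0 : (0 : ℝ) < k := by exact_mod_cast ha.trans_le (Finset.mem_Icc.1 hk).1
  rw [← Real.log_div (by positivity) hk0.ne']
  refine (Real.log_le_sub_one_of_pos (by positivity)).trans_eq ?_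
  field_simp
  push_cast
  ring

theorem tendsto_sum_Icc_ceil_sqrt_floor_inv :
    Filter.Tendsto (fun x : ℝ => ∑ k ∈ Finset.Icc ⌈Real.sqrt x⌉₊ ⌊x⌋₊, (k : ℝ)⁻¹)
      Filter.atTop Filter.atTop := by
  have hlog : Filter.Tendsto (fun x : ℝ => Real.log (Real.sqrt x / 2)) Filter.atTop Filter.atTop :=
    Real.tendsto_log_atTop.comp (Real.tendsto_sqrt_atTop.atTop_div_const two_pos)
  refine Filter.tendsto_atTop_mono' _ ?_ hlog
  filter_upwards [Filter.eventually_ge_atTop 1] with x hx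
  have hs : 1 ≤ Real.sqrt x := Real.one_le_sqrt.2 hx
  have hsq : Real.sqrt x ^ 2 = x := Real.sq_sqrt (by linarith)
  have hpos : 0 < ⌈Real.sqrt x⌉₊ := Nat.ceil_pos.2 (by linarith)
  have hceil := Nat.ceil_lt_add_one (Real.sqrt_nonneg x)
  have hfloor := Nat.lt_floor_add_one x
  refine le_trans (Real.log_le_log (by positivity) ?_) (log_div_le_sum_Icc_inv hpos ?_)
  · rw [div_le_div_iff₀ two_pos (by exact_mod_cast hpos)]
    nlinarith
  · refine Nat.ceil_le.2 ?_
    push_cast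
    nlinarith

open Classical in
theorem sum_card_embedding {F : Type*} [Field F] [Fintype F] {d : ℕ} {Ω : Finset F[X]}
    (hΩ : ∀ f, f ∈ Ω ↔ f.degree = d) {ι : Type*} [Fintype ι] (hι : Fintype.card ι ≤ d)
    (σ : ι → ι) :
    (∑ f ∈ Ω, Finset.card {c : ι ↪ F | ∀ i, f.eval (c i) = c (σ i)}) *
        Fintype.card F ^ Fintype.card ι =
      (Fintype.card F).descFactorial (Fintype.card ι) * Ω.card := by
  have hΩcard : Ω.card = Fintype.card F ^ d * (Fintype.card F - 1) := by
    rw [← (ncard_degree_eq F d).2, ← Set.ncard_coe_finset]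
    congr 1
    ext f
    exact hΩ f
  have hfiber (c : ι ↪ F) : (Ω.filter fun f => ∀ i, f.eval (c i) = c (σ i)).card =
      Fintype.card F ^ (d - Fintype.card ι) * (Fintype.card F - 1) := by
    have h := ncard_degree_eq_and_eval_eq (d := d) (Finset.univ.map c) (by simpa using hι)
      (Function.extend c (c ∘ σ) id)
    rw [Finset.card_map, Finset.card_univ] at h
    rw [← h, ← Set.ncard_coe_finset]
    congr 1
    ext f
    simp [hΩ, c.injective.extend_apply]
  have hswap := Finset.sum_card_bipartiteAbove_eq_sum_card_bipartiteBelow (s := Ω)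
    (t := (Finset.univ : Finset (ι ↪ F))) (fun f c => ∀ i, f.eval (c i) = c (σ i))
  simp only [Finset.bipartiteAbove, Finset.bipartiteBelow] at hswap
  rw [hswap, Finset.sum_congr rfl fun c _ => hfiber c, Finset.sum_const, Finset.card_univ,
    Fintype.card_embedding_eq, smul_eq_mul, hΩcard, mul_assoc]
  congr 1
  rw [mul_right_comm, ← pow_add, Nat.sub_add_cancel hι]

open Classical in
theorem sum_card_embedding_le {F : Type*} [Field F] [Fintype F] {d : ℕ} {Ω : Finset F[X]}
    (hΩ : ∀ f, f ∈ Ω ↔ f.degree = d) {ι : Type*} [Fintype ι] (hι : Fintype.card ι ≤ d)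
    (σ : ι → ι) :
    ∑ f ∈ Ω, Finset.card {c : ι ↪ F | ∀ i, f.eval (c i) = c (σ i)} ≤ Ω.card := by
  have hq : 0 < Fintype.card F ^ Fintype.card ι := pow_pos Fintype.card_pos _
  refine Nat.le_of_mul_le_mul_right ?_ hq
  rw [sum_card_embedding hΩ hι, mul_comm]
  exact Nat.mul_le_mul_left _ (Nat.descFactorial_le_pow _ _)

open Classical in
theorem le_sum_card_embedding {F : Type*} [Field F] [Fintype F] {d : ℕ} {Ω : Finset F[X]}
    (hΩ : ∀ f, f ∈ Ω ↔ f.degree = d) {ι : Type*} [Fintype ι] (hι : Fintype.card ι ≤ d)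
    (σ : ι → ι) :
    (1 - (d : ℝ) ^ 2 / Fintype.card F) * Ω.card ≤
      ∑ f ∈ Ω, (Finset.card {c : ι ↪ F | ∀ i, f.eval (c i) = c (σ i)} : ℝ) := by
  have hq : (0 : ℝ) < Fintype.card F := by exact_mod_cast Fintype.card_pos
  have h := sum_card_embedding hΩ hι σ
  have h' := congrArg (Nat.cast : ℕ → ℝ) h
  push_cast at h'
  refine le_of_mul_le_mul_right ?_ (pow_pos hq (Fintype.card ι))
  rw [h', mul_right_comm]
  gcongr
  refine le_trans ?_ (pow_mul_one_sub_le_descFactorial Fintype.card_pos (Fintype.card ι))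
  rw [mul_comm]
  gcongr

open Classical in
/-- Second-moment bound for the polynomials of degree `d` without a cycle whose length lies
in `K`. -/
theorem polyProb_mul_sq_le {F : Type*} [Field F] [Fintype F] {d : ℕ} {K : Finset ℕ}
    (hK : ∀ k ∈ K, 0 < k ∧ 2 * k ≤ d) {P : F[X] → Prop}
    (hP : ∀ f, P f → ∀ k ∈ K, ∀ x, Function.minimalPeriod (fun y => f.eval y) x ≠ k) :
    polyProb F d P * (∑ k ∈ K, (k : ℝ)⁻¹) ^ 2 ≤
      ∑ k ∈ K, (k : ℝ)⁻¹ +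
        2 * ((d : ℝ) ^ 2 / Fintype.card F) * (∑ k ∈ K, (k : ℝ)⁻¹) ^ 2 := by
  obtain ⟨hfin, hcard⟩ := ncard_degree_eq F d
  set Ω : Finset F[X] := hfin.toFinset
  have hΩ (f : F[X]) : f ∈ Ω ↔ f.degree = d := by simp [Ω]
  have hΩcard : (Ω.card : ℝ) = (Fintype.card F : ℝ) ^ d * ((Fintype.card F : ℝ) - 1) := by
    rw [← Set.ncard_eq_toFinset_card _ hfin, hcard, Nat.cast_mul, Nat.cast_pow,
      Nat.cast_pred Fintype.card_pos]
  have hΩpos : (0 : ℝ) < Ω.card := by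
    rw [hΩcard]
    have : (1 : ℝ) < Fintype.card F := by exact_mod_cast Fintype.one_lt_card
    have := sub_pos.2 this
    positivity
  have hB : polyProb F d P = (Ω.filter P).card / Ω.card := by
    rw [polyProb, hΩcard, ← Set.ncard_coe_finset, ← Nat.card_coe_set_eq]
    have hset : {f : F[X] | f.degree = (d : WithBot ℕ) ∧ P f} = ↑(Ω.filter P) := by
      ext f
      simp [hΩ]
    rw [hset]
  have hsingle (f : F[X]) {k : ℕ} (hk : k ∈ K) :=
    card_minimalPeriod_eq (fun y => f.eval y) (hK k hk).1
  have key := card_eq_zero_mul_sq_le Ω K (fun k hk => (hK k hk).1)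
    (fun f k => (Finset.card {x | Function.minimalPeriod (fun y => f.eval y) x = k} : ℝ))
    ((d : ℝ) ^ 2 / Fintype.card F) ?_ ?_ ?_ (Finset.filter_subset P Ω) ?_
  · rw [hB, div_mul_eq_mul_div, div_le_iff₀ hΩpos]
    exact key
  · intro k hk
    rw [Finset.sum_congr rfl fun f _ => by rw [hsingle f hk]]
    have hkd := (hK k hk).2
    have h := sum_card_embedding_le hΩ (ι := Fin k) (by rw [Fintype.card_fin]; omega) (finRotate k)
    rw [← Nat.cast_sum, Nat.cast_le]
    convert h
  · intro k hk
    rw [Finset.sum_congr rfl fun f _ => by rw [hsingle f hk]]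
    have hkd := (hK k hk).2
    convert le_sum_card_embedding hΩ (ι := Fin k) (by rw [Fintype.card_fin]; omega) (finRotate k)
  · intro j hj k hk
    obtain ⟨hj0, hjd⟩ := hK j hj
    obtain ⟨hk0, hkd⟩ := hK k hk
    have hpairs := Finset.sum_le_sum fun (f : F[X]) (_ : f ∈ Ω) =>
      card_minimalPeriod_mul_card_minimalPeriod_le (fun y => f.eval y) hj0 hk0
    rw [Finset.sum_add_distrib] at hpairs
    have hemb := sum_card_embedding_le hΩ (ι := Fin j ⊕ Fin k)
      (by rw [Fintype.card_sum, Fintype.card_fin, Fintype.card_fin]; omega)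
      (Sum.map (finRotate j) (finRotate k))
    have h := hpairs.trans (Nat.add_le_add_right hemb _)
    split_ifs at h ⊢
    · rw [← Finset.mul_sum] at h
      exact_mod_cast h
    · rw [Finset.sum_const_zero] at h
      exact_mod_cast h
  · intro f hf k hk
    rw [Nat.cast_eq_zero, Finset.card_eq_zero, Finset.filter_eq_empty_iff]
    exact fun x _ => hP f (Finset.mem_filter.1 hf).2 k hk x

/-- If `d = d(q) → ∞` with `d = o(√q)`, then all but a vanishing
proportion of polynomials in `Ω(q,d)` have at least one cycle whose length `k` lies in
`[√(d/2), d/2]`: for every `ε > 0` there are `D` and `δ > 0` such that for every finite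
field `F` with `q` elements and every `d` with `D ≤ d` and `d ≤ δ√q`, the proportion of
polynomials with no such cycle is at most `ε`. -/
theorem stmt10 (ε : ℝ) (hε : 0 < ε) :
    ∃ (D : ℕ) (δ : ℝ), 0 < δ ∧ ∀ (F : Type) [Field F] [Fintype F], ∀ d : ℕ,
      D ≤ d → (d : ℝ) ≤ δ * Real.sqrt (Fintype.card F) →
      polyProb F d (fun f => ¬ ∃ k : ℕ,
          (Real.sqrt ((d : ℝ) / 2) ≤ (k : ℝ) ∧ (k : ℝ) ≤ (d : ℝ) / 2) ∧
          ∃ x : F, Function.minimalPeriod (fun y => f.eval y) x = k) ≤ ε := by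
  have htend := tendsto_sum_Icc_ceil_sqrt_floor_inv.comp
    (tendsto_natCast_atTop_atTop.atTop_div_const (two_pos (α := ℝ)))
  obtain ⟨D, hD⟩ := Filter.eventually_atTop.1 (htend.eventually_ge_atTop (2 / ε))
  refine ⟨max D 1, Real.sqrt (ε / 4), by positivity, fun F _ _ d hd hdq => ?_⟩
  have hd0 : (0 : ℝ) < d := by exact_mod_cast (le_max_right D 1).trans hd
  have hq : (0 : ℝ) < Fintype.card F := by exact_mod_cast Fintype.card_pos
  have hη : (d : ℝ) ^ 2 / Fintype.card F ≤ ε / 4 := by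
    rw [div_le_iff₀ hq]
    calc (d : ℝ) ^ 2 ≤ (Real.sqrt (ε / 4) * Real.sqrt (Fintype.card F)) ^ 2 := by gcongr
      _ = ε / 4 * Fintype.card F := by
        rw [mul_pow, Real.sq_sqrt (by positivity), Real.sq_sqrt hq.le]
  have hmem (k : ℕ) : k ∈ Finset.Icc ⌈Real.sqrt ((d : ℝ) / 2)⌉₊ ⌊(d : ℝ) / 2⌋₊ ↔
      Real.sqrt ((d : ℝ) / 2) ≤ k ∧ (k : ℝ) ≤ (d : ℝ) / 2 := by
    rw [Finset.mem_Icc, Nat.ceil_le, Nat.le_floor_iff (by positivity)]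
  have hH := hD d ((le_max_left D 1).trans hd)
  simp only [Function.comp_apply] at hH
  set K := Finset.Icc ⌈Real.sqrt ((d : ℝ) / 2)⌉₊ ⌊(d : ℝ) / 2⌋₊
  set H := ∑ k ∈ K, (k : ℝ)⁻¹
  have hH0 : 0 < H := (by positivity : 0 < 2 / ε).trans_le hH
  rw [div_le_iff₀ hε] at hH
  have hK : ∀ k ∈ K, 0 < k ∧ 2 * k ≤ d := by
    intro k hk
    obtain ⟨h1, h2⟩ := (hmem k).1 hk
    refine ⟨?_, ?_⟩
    · exact_mod_cast (Real.sqrt_pos.2 (by positivity)).trans_le h1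
    · rw [le_div_iff₀ two_pos, mul_comm] at h2
      exact_mod_cast h2
  refine le_of_mul_le_mul_right ((polyProb_mul_sq_le hK ?_).trans ?_) (pow_pos hH0 2)
  · exact fun f hf k hk x hx => hf ⟨k, (hmem k).1 hk, x, hx⟩
  · have := mul_le_mul_of_nonneg_right hη (sq_nonneg H)
    nlinarith
end

section
/- Let V be a finite set, let A be a nonempty subset of V, and let σ be a permutation of A. Then |A|! · |{f : V → V : cyclic(f) = A and the restriction of f to A equals σ}| = |{f : V → V : cyclic(f) = A}|. (Equivalently, for a uniformly random function f : V → V, conditioned on cyclic(f) = A, the restriction σ_f of f to A is uniformly distributed over the |A|! permutations of A.) -/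
/-- The set of periodic (cyclic) points of `f : V → V`: those `x` with `f^[k] x = x`
for some `k ≥ 1`. -/
def cyclicSet {V : Type*} (f : V → V) : Set V :=
  {x | ∃ k : ℕ, 0 < k ∧ f^[k] x = x}

open Function Set in
/-- A map that permutes a finite set `s` has only periodic points in `s`. -/
theorem subset_cyclicSet_of_bijOn {V : Type*} {f : V → V} {s : Set V} (hs : s.Finite)
    (hf : BijOn f s s) : s ⊆ cyclicSet f := by
  intro x hx
  have := hs.to_subtype
  have h : (⟨x, hx⟩ : s) ∈ periodicPts (hf.mapsTo.restrict f s s) :=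
    (hf.mapsTo.restrict_inj.2 hf.injOn).mem_periodicPts _
  have hsemi : Semiconj (Subtype.val : s → V) (hf.mapsTo.restrict f s s) f := fun _ => rfl
  exact hsemi.mapsTo_periodicPts h

open Function Set in
/-- Modifying `f` on its set of periodic points, so that it still permutes this set, does not
change the set of periodic points. -/
theorem cyclicSet_eq_of_eqOn_compl {V : Type*} {f g : V → V} {s : Set V} (hs : s.Finite)
    (hf : cyclicSet f = s) (hg : BijOn g s s) (hfg : EqOn g f sᶜ) : cyclicSet g = s := by
  refine Subset.antisymm ?_ (subset_cyclicSet_of_bijOn hs hg)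
  rintro x ⟨k, hk, hx⟩
  by_contra hxs
  have hout : ∀ n, g^[n] x ∉ s := by
    intro n hn
    have hle : n ≤ k * n := Nat.le_mul_of_pos_left n hk
    have hper : g^[k * n] x = x := IsPeriodicPt.mul_const hx n
    rw [← Nat.sub_add_cancel hle, iterate_add_apply] at hper
    exact hxs (hper ▸ hg.mapsTo.iterate _ hn)
  have heq : ∀ n, g^[n] x = f^[n] x := by
    intro n
    induction n with
    | zero => rfl
    | succ n ih =>
      rw [iterate_succ_apply', iterate_succ_apply', ← ih]
      exact hfg (hout n)
  exact hxs (hf ▸ ⟨k, hk, (heq k).symm.trans hx⟩)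

open Function Set in
theorem bijOn_cyclicSet {V : Type*} (f : V → V) : BijOn f (cyclicSet f) (cyclicSet f) :=
  bijOn_periodicPts f

open Equiv.Perm Set in
theorem bijOn_ofSubtype {V : Type*} (A : Finset V) [DecidablePred (· ∈ A)]
    (π : Equiv.Perm A) : BijOn (ofSubtype π) (A : Set V) A := by
  refine (ofSubtype π).bijOn fun x => ?_
  exact (ofSubtype_apply_mem_iff_mem π x)

open Equiv.Perm Set in
/-- Precomposing with a permutation of the set of periodic points preserves this set. -/
theorem cyclicSet_comp_ofSubtype {V : Type*} {A : Finset V} [DecidablePred (· ∈ A)]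
    {f : V → V} (hf : cyclicSet f = A) (π : Equiv.Perm A) :
    cyclicSet (f ∘ ofSubtype π) = A := by
  refine cyclicSet_eq_of_eqOn_compl A.finite_toSet hf ?_ fun x hx => ?_
  · exact (hf ▸ bijOn_cyclicSet f).comp (bijOn_ofSubtype A π)
  · exact congrArg f (ofSubtype_apply_of_not_mem π hx)

/-- For a finite set `V`, a nonempty `A ⊆ V` and a permutation `σ` of
`A`, `|A|! · |{f : cyclic(f) = A and f restricted to A equals σ}| = |{f : cyclic(f) = A}|`;
i.e. conditioned on `cyclic(f) = A`, the restriction of a uniformly random `f` to `A` is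
uniformly distributed over the `|A|!` permutations of `A`. -/
theorem stmt11 {V : Type*} [Fintype V] (A : Finset V) (hA : A.Nonempty)
    (σ : Equiv.Perm A) :
    A.card.factorial * Nat.card {f : V → V |
        cyclicSet f = (A : Set V) ∧ ∀ a : A, f (a : V) = ((σ a : V))} =
      Nat.card {f : V → V | cyclicSet f = (A : Set V)} := by
  classical
  rw [← Fintype.card_coe A, ← Fintype.card_perm, ← Nat.card_eq_fintype_card, ← Nat.card_prod]
  refine Nat.card_eq_of_bijective
    (fun p => ⟨p.2.1 ∘ Equiv.Perm.ofSubtype p.1, cyclicSet_comp_ofSubtype p.2.2.1 p.1⟩)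
    ⟨?_, ?_⟩
  · rintro ⟨π, f, hf, hfσ⟩ ⟨ρ, g, hg, hgσ⟩ h
    have hfun : f ∘ Equiv.Perm.ofSubtype π = g ∘ Equiv.Perm.ofSubtype ρ :=
      congrArg Subtype.val h
    have hπρ : π = ρ := by
      ext a : 1
      have ha := congrFun hfun a
      simp only [Function.comp_apply, Equiv.Perm.ofSubtype_apply_coe, hfσ, hgσ] at ha
      exact σ.injective (Subtype.ext ha)
    subst hπρ
    have hfg : f = g := (Equiv.Perm.ofSubtype π).surjective.injective_comp_right hfun
    subst hfg
    rfl
  · rintro ⟨g, hg⟩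
    have hbij : Set.BijOn g A A := Eq.subst (motive := fun s => Set.BijOn g s s) hg
      (bijOn_cyclicSet g)
    let τ : Equiv.Perm A := hbij.equiv
    have hτ : ∀ a : A, g a = τ a := fun _ => rfl
    refine ⟨(σ⁻¹ * τ, ⟨g ∘ Equiv.Perm.ofSubtype (σ⁻¹ * τ)⁻¹,
      cyclicSet_comp_ofSubtype hg _, fun a => ?_⟩), Subtype.ext (funext fun x => ?_)⟩
    · simp [Equiv.Perm.ofSubtype_apply_coe, hτ, -map_mul, -map_inv]
    · simp only [Function.comp_apply, ← Equiv.Perm.mul_apply, ← map_mul, inv_mul_cancel, map_one,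
        Equiv.Perm.one_apply]
end

section
/- There is an absolute constant C > 0 such that for every finite field F with q elements, every nonempty subset A of F, every permutation σ of A, and every integer d ≥ 2|A|: | P_d({(f,g) ∈ U(q,d) : R_{f,g}(a) = σ(a) for all a ∈ A}) − q^(−|A|) | ≤ C · (|A|/q) · q^(−|A|). -/
open Polynomial
open scoped Classical

/-- `U(q,d)`: pairs `(f,g)` of degree-`d` polynomials with `g` monic and `f, g` coprime. -/
def Uset (F : Type*) [Field F] (d : ℕ) : Set (Polynomial F × Polynomial F) :=
  {fg | fg.1.degree = (d : WithBot ℕ) ∧ fg.2.degree = (d : WithBot ℕ) ∧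
    fg.2.Monic ∧ IsCoprime fg.1 fg.2}

/-- The rational map `R_{f,g} : F ∪ {∞} → F ∪ {∞}` (with `none` playing the role of `∞`):
`R(x) = f(x)/g(x)` if `g(x) ≠ 0`, `R(x) = ∞` if `g(x) = 0`, and `R(∞)` is the leading
coefficient of `f`. -/
noncomputable def rmap {F : Type*} [Field F] (f g : Polynomial F) :
    Option F → Option F
  | none => some f.leadingCoeff
  | some a => if g.eval a = 0 then none else some (f.eval a / g.eval a)

/-- The uniform probability measure `P_d` on `U(q,d)`, evaluated on the event `P`. -/
noncomputable def ratProb (F : Type*) [Field F] [Fintype F] (d : ℕ)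
    (P : Polynomial F × Polynomial F → Prop) : ℝ :=
  (Nat.card {fg : Polynomial F × Polynomial F | fg ∈ Uset F d ∧ P fg} : ℝ) /
    (Nat.card (Uset F d) : ℝ)

/-- The expectation `E_d` with respect to the uniform probability measure on `U(q,d)`. -/
noncomputable def ratExp (F : Type*) [Field F] [Fintype F] (d : ℕ)
    (X : Polynomial F × Polynomial F → ℝ) : ℝ :=
  (∑ᶠ fg : (Uset F d), X fg.val) / (Nat.card (Uset F d) : ℝ)

lemma geom_sum_Icc_sub (q e : ℕ) (hq : 1 ≤ q) {m : ℕ} (hm : m ≤ e) :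
    ∑ k ∈ Finset.Icc 1 m, (q - 1) * q ^ (e - k) + q ^ (e - m) = q ^ e := by
  induction m with
  | zero => simp
  | succ m ih =>
    rw [← ih (by omega), Finset.sum_Icc_succ_top (by omega), add_assoc]
    congr 1
    obtain ⟨r, rfl⟩ := Nat.exists_eq_add_of_le' hq
    rw [show e - m = e - (m + 1) + 1 by omega, pow_succ, Nat.add_sub_cancel]
    ring

section Counting

variable {F : Type} [Field F]

/-- Polynomials of degree less than `j` taking the values `v` on `B`. -/
def interpLT (j : ℕ) (B : Finset F) (v : F → F) : Set F[X] :=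
  {p | p.degree < (j : WithBot ℕ) ∧ ∀ b ∈ B, p.eval b = v b}

/-- Polynomials of degree exactly `j` taking the values `v` on `B`. -/
def interpEq (j : ℕ) (B : Finset F) (v : F → F) : Set F[X] :=
  {p | p.degree = (j : WithBot ℕ) ∧ ∀ b ∈ B, p.eval b = v b}

/-- Monic polynomials of degree `j` taking the values `v` on `B`. -/
def interpMonic (j : ℕ) (B : Finset F) (v : F → F) : Set F[X] :=
  {p | p.degree = (j : WithBot ℕ) ∧ p.Monic ∧ ∀ b ∈ B, p.eval b = v b}

/-- Pairs `(f, g)` with `g ∈ S`, `deg f = j` and `f = s * g` on `A`. -/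
def interpPairs (S : Set F[X]) (j : ℕ) (A : Finset F) (s : F → F) : Set (F[X] × F[X]) :=
  {fg | fg.2 ∈ S ∧ fg.1 ∈ interpEq j A (fun a => s a * fg.2.eval a)}

lemma interpMonic_eq_image (j : ℕ) (B : Finset F) (v : F → F) :
    interpMonic j B v = (fun p => X ^ j + p) '' interpLT j B (fun b => v b - b ^ j) := by
  ext p
  simp only [interpMonic, interpLT, Set.mem_ofPred_eq, Set.mem_image]
  constructor
  · rintro ⟨hd, hm, hv⟩
    refine ⟨p - X ^ j, ⟨?_, fun b hb => by simp [hv b hb]⟩, by ring⟩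
    rw [← hd]
    exact degree_sub_lt_left (by simp [hd]) hm.ne_zero (by simp [hm.leadingCoeff])
  · rintro ⟨r, ⟨hd, hv⟩, rfl⟩
    refine ⟨?_, monic_X_pow_add hd, fun b hb => by simp [hv b hb]⟩
    rw [degree_add_eq_left_of_degree_lt (by simpa using hd), degree_X_pow]

lemma ncard_interpPairs_le {S : Set F[X]} (hS : S.Finite) {j : ℕ} {A : Finset F}
    (hA : j < A.card) (s : F → F) : (interpPairs S j A s).ncard ≤ S.ncard := by
  refine Set.ncard_le_ncard_of_injOn Prod.snd (fun x hx => hx.1) ?_ hS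
  rintro ⟨f, g⟩ hf ⟨f', g'⟩ hf' (rfl : g = g')
  have hlt : (j : WithBot ℕ) < (A.card : WithBot ℕ) := by exact_mod_cast hA
  have : f = f' := eq_of_degrees_lt_of_eval_finset_eq A (hf.2.1.trans_lt hlt)
    (hf'.2.1.trans_lt hlt) fun a ha => (hf.2.2 a ha).trans (hf'.2.2 a ha).symm
  rw [this]

/-- Pairs in `Uset F d` with `f = s * g` on `A`. -/
def coprimePairs (d : ℕ) (A : Finset F) (s : F → F) : Set (F[X] × F[X]) :=
  {fg | fg ∈ Uset F d ∧ ∀ a ∈ A, fg.1.eval a = s a * fg.2.eval a}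

/-- Non-coprime pairs with `f = s * g` on `A`, where `g` has no zero on `A`. -/
def nonCoprimePairs (d : ℕ) (A : Finset F) (s : F → F) : Set (F[X] × F[X]) :=
  {fg | fg ∈ interpPairs (interpMonic d ∅ 0) d A s ∧ (∀ a ∈ A, fg.2.eval a ≠ 0) ∧
    ¬ IsCoprime fg.1 fg.2}

lemma exists_monic_dvd_of_not_isCoprime {f g : F[X]} (hg : g ≠ 0) (h : ¬ IsCoprime f g) :
    ∃ p : F[X], p.Monic ∧ 1 ≤ p.natDegree ∧ p ∣ f ∧ p ∣ g := by
  by_contra! H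
  refine h (isCoprime_of_irreducible_dvd (fun h0 => hg h0.2) fun z hz hzf hzg => ?_)
  have hu : IsUnit (C z.leadingCoeff⁻¹) := by
    simpa [isUnit_C] using hz.ne_zero
  have hdeg : (z * C z.leadingCoeff⁻¹).natDegree = z.natDegree :=
    natDegree_mul_C (inv_ne_zero (leadingCoeff_ne_zero.2 hz.ne_zero))
  exact H _ (monic_mul_leadingCoeff_inv hz.ne_zero) (hdeg ▸ hz.natDegree_pos)
    (hu.mul_right_dvd.2 hzf) (hu.mul_right_dvd.2 hzg)

lemma nonCoprimePairs_subset (d : ℕ) (A : Finset F) (s : F → F) :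
    nonCoprimePairs d A s ⊆ ⋃ k ∈ Finset.Icc 1 d,
      (fun x : F[X] × F[X] × F[X] => (x.1 * x.2.1, x.1 * x.2.2)) ''
        (interpMonic k ∅ 0 ×ˢ interpPairs (interpMonic (d - k) ∅ 0) (d - k) A s) := by
  rintro ⟨f, g⟩ ⟨⟨⟨hgd, hgm, -⟩, hfd, hfA⟩, hgA, hnc⟩
  obtain ⟨p, hp, hp1, ⟨f', rfl⟩, ⟨g', rfl⟩⟩ :=
    exists_monic_dvd_of_not_isCoprime hgm.ne_zero hnc
  dsimp only at hgd hgm hfd hfA hgA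
  have key {r : F[X]} (hr : (p * r).degree = d) :
      p.natDegree ≤ d ∧ r.degree = ((d - p.natDegree : ℕ) : WithBot ℕ) := by
    have hr0 : r ≠ 0 := by rintro rfl; simp at hr
    have h1 := natDegree_eq_of_degree_eq_some hr
    rw [natDegree_mul hp.ne_zero hr0] at h1
    exact ⟨by omega, by rw [degree_eq_natDegree hr0]; congr 1; omega⟩
  refine Set.mem_biUnion (x := p.natDegree) (by simp [hp1, (key hgd).1]) ⟨(p, f', g'),
    ⟨⟨degree_eq_natDegree hp.ne_zero, hp, by simp⟩,
      ⟨(key hgd).2, hp.of_mul_monic_left hgm, by simp⟩, (key hfd).2, fun a ha => ?_⟩, rfl⟩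
  have h1 := hfA a ha
  have h2 := hgA a ha
  rw [eval_mul] at h1 h2
  rw [eval_mul] at h1
  apply mul_left_cancel₀ (left_ne_zero_of_mul h2)
  rw [h1]; dsimp only; ring

lemma coprimePairs_subset (d : ℕ) (A : Finset F) (s : F → F) :
    coprimePairs d A s ⊆ interpPairs (interpMonic d ∅ 0) d A s :=
  fun _ ⟨⟨h1, h2, h3, _⟩, h5⟩ => ⟨⟨h2, h3, by simp⟩, h1, h5⟩

lemma rmap_some_eq_some_iff {f g : F[X]} (h : IsCoprime f g) (a b : F) :
    rmap f g (some a) = some b ↔ f.eval a = b * g.eval a := by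
  by_cases hg : g.eval a = 0
  · have hf : f.eval a ≠ 0 := by
      intro hf
      obtain ⟨u, v, huv⟩ := h
      simpa [hf, hg] using congrArg (eval a) huv
    simp [rmap, hg, hf]
  · simp [rmap, hg, div_eq_iff]

variable [Fintype F]

lemma finite_degree_lt (j : ℕ) : {p : F[X] | p.degree < (j : WithBot ℕ)}.Finite := by
  have h : Finite (degreeLT F j) := Finite.of_equiv _ (degreeLTEquiv F j).toEquiv.symm
  refine (Set.toFinite (degreeLT F j : Set F[X])).subset fun p hp => ?_
  exact mem_degreeLT.2 hp

lemma ncard_degree_lt (j : ℕ) :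
    {p : F[X] | p.degree < (j : WithBot ℕ)}.ncard = Fintype.card F ^ j := by
  have h : {p : F[X] | p.degree < (j : WithBot ℕ)} = (degreeLT F j : Set F[X]) := by
    ext p; simp [mem_degreeLT]
  rw [h, ← Nat.card_coe_set_eq]
  exact (Nat.card_congr (degreeLTEquiv F j).toEquiv).trans (by simp)

lemma finite_interpLT (j : ℕ) (B : Finset F) (v : F → F) : (interpLT j B v).Finite :=
  (finite_degree_lt j).subset fun _ hp => hp.1

lemma finite_interpEq (j : ℕ) (B : Finset F) (v : F → F) : (interpEq j B v).Finite :=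
  (finite_degree_lt (j + 1)).subset fun p hp => by
    rw [Set.mem_ofPred_eq, hp.1]; exact_mod_cast Nat.lt_succ_self j

lemma finite_interpMonic (j : ℕ) (B : Finset F) (v : F → F) : (interpMonic j B v).Finite :=
  (finite_interpEq j B v).subset fun _ hp => ⟨hp.1, hp.2.2⟩

lemma finite_interpPairs {S : Set F[X]} (hS : S.Finite) (j : ℕ) (A : Finset F) (s : F → F) :
    (interpPairs S j A s).Finite :=
  ((finite_interpEq j ∅ 0).prod hS).subset fun _ h => ⟨⟨h.2.1, by simp⟩, h.1⟩

lemma ncard_interpLT {j : ℕ} {B : Finset F} (hB : B.card ≤ j) (v : F → F) :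
    (interpLT j B v).ncard * Fintype.card F ^ B.card = Fintype.card F ^ j := by
  obtain ⟨L, hL, hLd⟩ : ∃ L : (B → F) → F[X],
      (∀ (w : B → F) (b : F) (hb : b ∈ B), (L w).eval b = w ⟨b, hb⟩) ∧
        ∀ w, (L w).degree < (j : WithBot ℕ) := by
    refine ⟨fun w => Lagrange.interpolate B id (fun b => if h : b ∈ B then w ⟨b, h⟩ else 0),
      fun w b hb => ?_, fun w => (Lagrange.degree_interpolate_lt _
        Function.injective_id.injOn).trans_le (by exact_mod_cast hB)⟩
    exact (Lagrange.eval_interpolate_at_node (v := id) _ Function.injective_id.injOn hb).trans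
      (dif_pos hb)
  have key : Nat.card (interpLT j B v × (B → F)) =
      Nat.card {p : F[X] | p.degree < (j : WithBot ℕ)} := by
    refine Nat.card_eq_of_bijective (fun x => ⟨x.1.1 + L x.2,
      (degree_add_le _ _).trans_lt (max_lt x.1.2.1 (hLd _))⟩) ⟨?_, ?_⟩
    · rintro ⟨⟨p, hp⟩, w⟩ ⟨⟨p', hp'⟩, w'⟩ h
      simp only [Subtype.mk.injEq] at h
      have hw : w = w' := by
        ext ⟨b, hb⟩
        have := congrArg (eval b) h
        simpa [hp.2 b hb, hp'.2 b hb, hL _ b hb] using this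
      subst hw
      simpa using h
    · rintro ⟨r, hr⟩
      refine ⟨⟨⟨r - L (fun b => r.eval (b : F) - v b),
        (degree_sub_le _ _).trans_lt (max_lt hr (hLd _)), fun b hb => ?_⟩,
        fun b => r.eval (b : F) - v b⟩, by simp⟩
      simp [hL _ b hb]
  rw [Nat.card_prod, Nat.card_coe_set_eq, Nat.card_coe_set_eq, ncard_degree_lt] at key
  simpa using key

lemma ncard_interpMonic {j : ℕ} {B : Finset F} (hB : B.card ≤ j) (v : F → F) :
    (interpMonic j B v).ncard * Fintype.card F ^ B.card = Fintype.card F ^ j := by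
  rw [interpMonic_eq_image, Set.ncard_image_of_injective _ (add_right_injective _),
    ncard_interpLT hB]

lemma ncard_interpEq {j : ℕ} {B : Finset F} (hB : B.card ≤ j) (v : F → F) :
    (interpEq j B v).ncard * Fintype.card F ^ B.card =
      (Fintype.card F - 1) * Fintype.card F ^ j := by
  have h : interpEq j B v = interpLT (j + 1) B v \ interpLT j B v := by
    ext p
    simp only [interpEq, interpLT, Set.mem_ofPred_eq, Set.mem_sdiff, not_and]
    constructor
    · rintro ⟨h, h'⟩
      exact ⟨⟨by rw [h]; exact_mod_cast Nat.lt_succ_self j, h'⟩, fun h2 => absurd h h2.ne⟩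
    · rintro ⟨⟨h, h'⟩, h2⟩
      refine ⟨le_antisymm ?_ ?_, h'⟩
      · cases hd : p.degree with
        | bot => exact bot_le
        | coe m =>
          rw [hd] at h
          exact WithBot.coe_le_coe.2 (Nat.lt_succ_iff.1 (WithBot.coe_lt_coe.1 h))
      · by_contra h3
        exact h2 (not_le.1 h3) h'
  have hsub : interpLT j B v ⊆ interpLT (j + 1) B v := fun p hp =>
    ⟨hp.1.trans (by exact_mod_cast Nat.lt_succ_self j), hp.2⟩
  rw [h, Set.ncard_sdiff hsub (finite_interpLT j B v), Nat.sub_mul, ncard_interpLT hB,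
    ncard_interpLT (hB.trans (Nat.le_succ j)), Nat.sub_mul, pow_succ', one_mul]

lemma ncard_interpPairs {S : Set F[X]} (hS : S.Finite) {j : ℕ} {A : Finset F}
    (hA : A.card ≤ j) (s : F → F) :
    (interpPairs S j A s).ncard * Fintype.card F ^ A.card =
      S.ncard * ((Fintype.card F - 1) * Fintype.card F ^ j) := by
  have := hS.fintype
  have hfin (g : S) : Finite (interpEq j A (fun a => s a * (g : F[X]).eval a)) :=
    finite_interpEq j A _
  let e : interpPairs S j A s ≃ Σ g : S, interpEq j A (fun a => s a * (g : F[X]).eval a) :=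
    { toFun := fun x => ⟨⟨x.1.2, x.2.1⟩, ⟨x.1.1, x.2.2⟩⟩
      invFun := fun y => ⟨(y.2.1, y.1.1), y.1.2, y.2.2⟩
      left_inv := fun _ => rfl
      right_inv := fun _ => rfl }
  rw [← Nat.card_coe_set_eq, Nat.card_congr e, Nat.card_sigma, Finset.sum_mul]
  simp only [Nat.card_coe_set_eq, ncard_interpEq hA]
  rw [Finset.sum_const, Finset.card_univ, smul_eq_mul, ← Nat.card_eq_fintype_card,
    Nat.card_coe_set_eq]

lemma ncard_monic (j : ℕ) : (interpMonic (F := F) j ∅ 0).ncard = Fintype.card F ^ j := by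
  simpa using ncard_interpMonic (F := F) (B := ∅) (j := j) (by simp) 0

lemma ncard_nonCoprimePairs_le {d : ℕ} {A : Finset F} (hA : A.card ≤ d) (s : F → F) :
    (nonCoprimePairs d A s).ncard * Fintype.card F ^ A.card ≤
      (A.card + 1) * Fintype.card F ^ (2 * d) := by
  set q := Fintype.card F with hq
  have hq1 : 1 ≤ q := Fintype.card_pos
  set n := A.card with hn
  let W : ℕ → Set (F[X] × F[X]) := fun j => interpPairs (interpMonic j ∅ 0) j A s
  have hfin (k : ℕ) : (interpMonic k ∅ 0 ×ˢ W (d - k) : Set (F[X] × F[X] × F[X])).Finite :=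
    (finite_interpMonic _ _ _).prod (finite_interpPairs (finite_interpMonic _ _ _) _ _ _)
  have hterm : ∀ k ∈ Finset.Icc 1 d, q ^ k * (W (d - k)).ncard * q ^ n ≤
      (q - 1) * q ^ (2 * d - k) + if d - n < k then q ^ (2 * d) else 0 := by
    intro k hk
    rw [Finset.mem_Icc] at hk
    split_ifs with h
    · have h1 : (W (d - k)).ncard ≤ q ^ (d - k) := by
        rw [hq, ← ncard_monic]
        exact ncard_interpPairs_le (finite_interpMonic _ _ _) (by omega) s
      calc q ^ k * (W (d - k)).ncard * q ^ n ≤ q ^ k * q ^ (d - k) * q ^ d := by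
            gcongr
        _ = q ^ (2 * d) := by rw [← pow_add, ← pow_add]; congr 1; omega
        _ ≤ _ := Nat.le_add_left _ _
    · have h1 := ncard_interpPairs (finite_interpMonic (d - k) ∅ (0 : F → F))
        (j := d - k) (A := A) (by omega) s
      rw [ncard_monic, ← hq, ← hn] at h1
      rw [mul_assoc, h1, add_zero,
        show 2 * d - k = k + ((d - k) + (d - k)) by omega, pow_add, pow_add]
      apply le_of_eq
      ring
  have hcount : ((Finset.Icc 1 d).filter (fun k => d - n < k)).card ≤ n := by
    calc _ ≤ (Finset.Icc (d - n + 1) d).card :=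
          Finset.card_le_card fun k hk => by simp at hk ⊢; omega
      _ = n := by simp; omega
  calc (nonCoprimePairs d A s).ncard * q ^ n
      ≤ (∑ k ∈ Finset.Icc 1 d, q ^ k * (W (d - k)).ncard) * q ^ n := by
        gcongr
        refine (Set.ncard_le_ncard (nonCoprimePairs_subset d A s) ?_).trans
          ((Finset.set_ncard_biUnion_le _ _).trans (Finset.sum_le_sum fun k _ => ?_))
        · exact (Finset.finite_toSet _).biUnion fun k _ => (hfin k).image _
        · refine (Set.ncard_image_le (hfin k)).trans ?_
          rw [Set.ncard_prod, ncard_monic]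
    _ ≤ ∑ k ∈ Finset.Icc 1 d,
          ((q - 1) * q ^ (2 * d - k) + if d - n < k then q ^ (2 * d) else 0) := by
        rw [Finset.sum_mul]
        exact Finset.sum_le_sum hterm
    _ = ∑ k ∈ Finset.Icc 1 d, (q - 1) * q ^ (2 * d - k) +
          ((Finset.Icc 1 d).filter (fun k => d - n < k)).card * q ^ (2 * d) := by
        rw [Finset.sum_add_distrib, ← Finset.sum_filter, Finset.sum_const, smul_eq_mul]
    _ ≤ q ^ (2 * d) + n * q ^ (2 * d) := by
        gcongr
        rw [← geom_sum_Icc_sub q (2 * d) hq1 (show d ≤ 2 * d by omega)]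
        exact Nat.le_add_right _ _
    _ = (n + 1) * q ^ (2 * d) := by ring

lemma ncard_allPairs {d : ℕ} {A : Finset F} (hA : A.card ≤ d) (s : F → F) :
    (interpPairs (interpMonic d ∅ 0) d A s).ncard * Fintype.card F ^ A.card =
      (Fintype.card F - 1) * Fintype.card F ^ (2 * d) := by
  rw [ncard_interpPairs (finite_interpMonic _ _ _) hA, ncard_monic]
  ring

lemma ncard_coprimePairs_le {d : ℕ} {A : Finset F} (hA : A.card ≤ d) (s : F → F) :
    (coprimePairs d A s).ncard * Fintype.card F ^ A.card ≤
      (Fintype.card F - 1) * Fintype.card F ^ (2 * d) := by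
  rw [← ncard_allPairs hA s]
  gcongr
  · exact finite_interpPairs (finite_interpMonic _ _ _) _ _ _
  · exact coprimePairs_subset d A s

lemma le_ncard_coprimePairs {d : ℕ} {A : Finset F} (hA : A.card ≤ d) (s : F → F) :
    (Fintype.card F - 1) * Fintype.card F ^ (2 * d) ≤
      (coprimePairs d A s).ncard * Fintype.card F ^ A.card +
        (2 * A.card + 1) * Fintype.card F ^ (2 * d) := by
  have hq1 : 1 ≤ Fintype.card F := Fintype.card_pos
  let Z : F → Set (F[X] × F[X]) := fun a => interpPairs (interpMonic d {a} 0) d A s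
  have hsub : interpPairs (interpMonic d ∅ 0) d A s ⊆
      (coprimePairs d A s ∪ nonCoprimePairs d A s) ∪ ⋃ a ∈ A, Z a := by
    rintro ⟨f, g⟩ h
    have ⟨⟨hgd, hgm, _⟩, hfd, hfA⟩ := h
    by_cases hz : ∃ a ∈ A, g.eval a = 0
    · obtain ⟨a, ha, hga⟩ := hz
      exact Or.inr (Set.mem_biUnion ha ⟨⟨hgd, hgm, by simpa using hga⟩, hfd, hfA⟩)
    · push Not at hz
      by_cases hc : IsCoprime f g
      · exact Or.inl (Or.inl ⟨⟨hfd, hgd, hgm, hc⟩, hfA⟩)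
      · exact Or.inl (Or.inr ⟨h, hz, hc⟩)
  have hall := finite_interpPairs (finite_interpMonic d ∅ (0 : F → F)) d A s
  have hZfin (a : F) : (Z a).Finite := finite_interpPairs (finite_interpMonic _ _ _) _ _ _
  have hZ : ∀ a ∈ A, (Z a).ncard * Fintype.card F ^ A.card ≤ Fintype.card F ^ (2 * d) := by
    intro a ha
    have hd : 1 ≤ d := (Finset.card_pos.2 ⟨a, ha⟩).trans_le hA
    have h1 := ncard_interpMonic (B := {a}) (j := d) (by simpa using hd) 0
    rw [ncard_interpPairs (finite_interpMonic _ _ _) hA]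
    calc _ ≤ (interpMonic d {a} 0).ncard * (Fintype.card F * Fintype.card F ^ d) := by
          gcongr; exact Nat.sub_le _ _
      _ = (interpMonic d {a} 0).ncard * Fintype.card F ^ ({a} : Finset F).card *
          Fintype.card F ^ d := by simp; ring
      _ = _ := by rw [h1]; ring
  have hU : (interpPairs (interpMonic d ∅ 0) d A s).ncard ≤
      (coprimePairs d A s).ncard + (nonCoprimePairs d A s).ncard + ∑ a ∈ A, (Z a).ncard := by
    refine (Set.ncard_le_ncard hsub ?_).trans ((Set.ncard_union_le _ _).trans
      (add_le_add (Set.ncard_union_le _ _) (Finset.set_ncard_biUnion_le _ _)))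
    exact ((hall.subset (coprimePairs_subset d A s)).union
      (hall.subset fun _ h => h.1)).union ((Finset.finite_toSet _).biUnion fun a _ => hZfin a)
  have hsum : (∑ a ∈ A, (Z a).ncard) * Fintype.card F ^ A.card ≤
      A.card * Fintype.card F ^ (2 * d) := by
    rw [Finset.sum_mul]
    simpa using Finset.sum_le_card_nsmul A _ _ hZ
  have hnc := ncard_nonCoprimePairs_le hA s
  have h := Nat.mul_le_mul_right (Fintype.card F ^ A.card) hU
  rw [ncard_allPairs hA, add_mul, add_mul] at h
  linarith

end Counting

lemma abs_div_sub_inv_le_of_small {q n e u : ℝ} {m : ℕ} (hq : 1 ≤ q) (hq3 : q ≤ 3)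
    (hm : m ≤ 3) (hn : 1 ≤ n) (he : 0 ≤ e) (heu : e ≤ u) :
    |e / u - q⁻¹ ^ m| ≤ 81 * (n / q) * q⁻¹ ^ m := by
  have h0 : 0 ≤ e / u := div_nonneg he (he.trans heu)
  have h1 : e / u ≤ 1 := div_le_one_of_le₀ heu (he.trans heu)
  have h2 : q⁻¹ ^ m ≤ 1 := pow_le_one₀ (by positivity) (inv_le_one_of_one_le₀ hq)
  have h3 : 0 ≤ q⁻¹ ^ m := by positivity
  have h4 : q ^ (m + 1) ≤ 81 :=
    calc q ^ (m + 1) ≤ q ^ 4 := pow_le_pow_right₀ hq (by omega)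
      _ ≤ 3 ^ 4 := by gcongr
      _ = 81 := by norm_num
  have h5 : 1 ≤ 81 * (n / q) * q⁻¹ ^ m := by
    rw [show 81 * (n / q) * q⁻¹ ^ m = 81 * n / q ^ (m + 1) by
      rw [inv_pow, pow_succ]; field_simp]
    rw [le_div_iff₀ (by positivity)]
    linarith
  rw [abs_le]
  constructor <;> linarith

lemma abs_div_sub_inv_le_of_large {q n e u D x : ℝ} (hq : 4 ≤ q) (hn : 1 ≤ n) (hD : 0 < D)
    (hx : 0 < x) (h1 : e * x ≤ (q - 1) * D) (h2 : (q - 1) * D ≤ e * x + (2 * n + 1) * D)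
    (h3 : u ≤ (q - 1) * D) (h4 : (q - 1) * D ≤ u + D) :
    |e / u - x⁻¹| ≤ 81 * (n / q) * x⁻¹ := by
  have hu : q * D ≤ 2 * u := by nlinarith
  have hu0 : 0 < u := by nlinarith
  have hnD : D ≤ n * D := by nlinarith
  have habs : |e * x - u| ≤ 3 * (n * D) := by
    rw [abs_le]; constructor <;> linarith
  rw [show e / u - x⁻¹ = (e * x - u) / (u * x) by field_simp, abs_div,
    abs_of_pos (mul_pos hu0 hx), div_le_iff₀ (mul_pos hu0 hx),
    show 81 * (n / q) * x⁻¹ * (u * x) = 81 * n * u / q by field_simp]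
  refine habs.trans ?_
  rw [le_div_iff₀ (by linarith)]
  nlinarith [mul_nonneg (show (0 : ℝ) ≤ n by linarith) hu0.le,
    mul_le_mul_of_nonneg_left hu (show (0 : ℝ) ≤ n by linarith)]

/-- There is an absolute constant `C > 0` such that for every finite
field `F` with `q` elements, every nonempty `A ⊆ F`, every permutation `σ` of `A` and
every `d ≥ 2|A|`,
`| P_d(R_{f,g}(a) = σ(a) for all a ∈ A) − q^{-|A|} | ≤ C (|A|/q) q^{-|A|}`. -/
theorem stmt13 : ∃ C : ℝ, 0 < C ∧ ∀ (F : Type) [Field F] [Fintype F],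
    ∀ A : Finset F, A.Nonempty → ∀ σ : Equiv.Perm A, ∀ d : ℕ, 2 * A.card ≤ d →
    |ratProb F d (fun fg => ∀ a : A, rmap fg.1 fg.2 (some (a : F)) = some ((σ a : F))) -
        ((Fintype.card F : ℝ))⁻¹ ^ A.card| ≤
      C * ((A.card : ℝ) / (Fintype.card F : ℝ)) *
        ((Fintype.card F : ℝ))⁻¹ ^ A.card := by
  refine ⟨81, by norm_num, fun F _ _ A hA σ d hd => ?_⟩
  let s : F → F := fun a => if h : a ∈ A then (σ ⟨a, h⟩ : F) else 0
  have hset : {fg : F[X] × F[X] | fg ∈ Uset F d ∧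
      ∀ a : A, rmap fg.1 fg.2 (some (a : F)) = some ((σ a : F))} = coprimePairs d A s := by
    ext fg
    refine and_congr_right fun hU => ?_
    simp only [rmap_some_eq_some_iff hU.2.2.2, Subtype.forall]
    refine forall₂_congr fun a ha => ?_
    simp [s, ha]
  have hUset : Uset F d = coprimePairs d ∅ s := by
    ext fg; simp [coprimePairs]
  have hAd : A.card ≤ d := by omega
  have hq0 : 1 ≤ Fintype.card F := Fintype.card_pos
  have hn : (1 : ℝ) ≤ A.card := by exact_mod_cast hA.card_pos
  have hq : (1 : ℝ) ≤ Fintype.card F := by exact_mod_cast hq0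
  rw [ratProb, hset, Nat.card_coe_set_eq, Nat.card_coe_set_eq]
  by_cases hq3 : Fintype.card F ≤ 3
  · refine abs_div_sub_inv_le_of_small hq (by exact_mod_cast hq3)
      (A.card_le_univ.trans hq3) hn (by positivity) ?_
    have hfin : (Uset F d).Finite := by
      rw [hUset]
      exact (finite_interpPairs (finite_interpMonic _ _ _) _ _ _).subset
        (coprimePairs_subset d ∅ s)
    exact_mod_cast Set.ncard_le_ncard (show coprimePairs d A s ⊆ Uset F d from fun _ h => h.1) hfin
  · rw [inv_pow]
    have h1 := ncard_coprimePairs_le hAd s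
    have h2 := le_ncard_coprimePairs hAd s
    have h3 := ncard_coprimePairs_le (A := ∅) (d := d) (by simp) s
    have h4 := le_ncard_coprimePairs (A := ∅) (d := d) (by simp) s
    rw [← hUset] at h3 h4
    simp only [Finset.card_empty, pow_zero, mul_one, mul_zero, zero_add, one_mul] at h3 h4
    refine abs_div_sub_inv_le_of_large (D := (Fintype.card F : ℝ) ^ (2 * d))
      (by exact_mod_cast (by omega : 4 ≤ Fintype.card F)) hn (by positivity) (by positivity)
      ?_ ?_ ?_ ?_ <;> rw [← Nat.cast_one, ← Nat.cast_sub hq0] <;> exact_mod_cast ‹_›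
end
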